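/- Let q be 2 or 3 and let n >= 14 be a positive integer. Then there always exists an element α in F_{q^n}* such that both α and α^{-1} are simultaneously primitive and 1-normal over F_q. -/

import Mathlib

open Polynomial

noncomputable section

/-- The action `h ∘ β = Σ_i a_i β^{q^i}` of a polynomial `h = Σ_i a_i x^i` over `F_q`
on an element `β` of an extension field. -/
def polyAct {Fq F : Type*} [Field Fq] [Field F] [Algebra Fq F]
    (q : ℕ) (h : Fq[X]) (β : F) : F :=
  h.sum fun i a => algebraMap Fq F a * β ^ q ^ i

/-- `h` is the `F_q`-order of `β`: the monic divisor of `x^n - 1` of least degree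
annihilating `β`. -/
def IsFqOrder {Fq F : Type*} [Field Fq] [Field F] [Algebra Fq F]
    (q n : ℕ) (h : Fq[X]) (β : F) : Prop :=
  h.Monic ∧ h ∣ (X ^ n - 1 : Fq[X]) ∧ polyAct q h β = 0 ∧
    ∀ h' : Fq[X], h'.Monic → h' ∣ (X ^ n - 1 : Fq[X]) → polyAct q h' β = 0 →
      h.natDegree ≤ h'.natDegree

/-- `α` is `k`-normal over `F_q`: its `F_q`-order has degree `n - k`. -/
def IsKNormal (Fq : Type*) {F : Type*} [Field Fq] [Field F] [Algebra Fq F]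
    (q n k : ℕ) (α : F) : Prop :=
  ∃ h : Fq[X], IsFqOrder q n h α ∧ h.natDegree = n - k

set_option linter.unusedSectionVars false

section Kloosterman

variable {F : Type*} [Field F] [Fintype F] [DecidableEq F]

open Finset

/-- The incomplete Kloosterman sum over `U`. -/
def kloostermanSum (ψ : AddChar F ℂ) (U : Finset F) (a b : F) : ℂ :=
  ∑ x ∈ U, ψ (a * x + b * x⁻¹)

theorem AddChar.conj_apply_finite (ψ : AddChar F ℂ) (x : F) :
    (starRingEnd ℂ) (ψ x) = ψ (-x) := (AddChar.map_neg_eq_conj ψ x).symm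

theorem sum_normSq_expSum {ψ : AddChar F ℂ} (hψ : ψ.IsPrimitive) {ι : Type*} [DecidableEq ι]
    (s : Finset ι) (f g : ι → F) :
    ∑ a : F, ∑ b : F, ‖∑ i ∈ s, ψ (a * f i + b * g i)‖ ^ 2 =
      (Fintype.card F : ℝ) ^ 2 *
        #{z ∈ s ×ˢ s | f z.1 = f z.2 ∧ g z.1 = g z.2} := by
  have key : ∀ a b : F, ((‖∑ i ∈ s, ψ (a * f i + b * g i)‖ ^ 2 : ℝ) : ℂ) =
      ∑ z ∈ s ×ˢ s, ψ (a * (f z.1 - f z.2)) * ψ (b * (g z.1 - g z.2)) := by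
    intro a b
    push_cast
    rw [← Complex.mul_conj', map_sum, sum_mul_sum, sum_product]
    refine sum_congr rfl fun i _ => sum_congr rfl fun j _ => ?_
    rw [AddChar.conj_apply_finite, ← AddChar.map_add_eq_mul, ← AddChar.map_add_eq_mul]
    congr 1; ring
  have : ((∑ a : F, ∑ b : F, ‖∑ i ∈ s, ψ (a * f i + b * g i)‖ ^ 2 : ℝ) : ℂ) =
      ((Fintype.card F : ℝ) ^ 2 *
        #{z ∈ s ×ˢ s | f z.1 = f z.2 ∧ g z.1 = g z.2} : ℝ) := by
    rw [Complex.ofReal_sum]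
    simp_rw [Complex.ofReal_sum, key]
    have h1 : ∀ a : F, ∑ b : F, ∑ z ∈ s ×ˢ s,
        ψ (a * (f z.1 - f z.2)) * ψ (b * (g z.1 - g z.2)) =
        ∑ z ∈ s ×ˢ s, ψ (a * (f z.1 - f z.2)) * ∑ b : F, ψ (b * (g z.1 - g z.2)) := by
      intro a; rw [sum_comm]; simp_rw [mul_sum]
    simp_rw [h1]
    rw [sum_comm]
    simp_rw [← sum_mul, AddChar.sum_mulShift _ hψ, sub_eq_zero]
    rw [card_filter]
    push_cast
    rw [mul_sum]
    refine sum_congr rfl fun z _ => ?_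
    by_cases h : f z.1 = f z.2 <;> by_cases h' : g z.1 = g z.2 <;> simp [h, h', sq]
  exact_mod_cast this

theorem sum_kloostermanSum_pow_four_le {ψ : AddChar F ℂ} (hψ : ψ.IsPrimitive) {U : Finset F}
    (hU : ∀ x ∈ U, x ≠ 0) :
    ∑ a : F, ∑ b : F, ‖kloostermanSum ψ U a b‖ ^ 4 ≤
      3 * (Fintype.card F : ℝ) ^ 2 * (#U : ℝ) ^ 2 := by
  have h1 : ∀ a b : F, ‖kloostermanSum ψ U a b‖ ^ 4 =
      ‖∑ z ∈ U ×ˢ U, ψ (a * (z.1 + z.2) + b * (z.1⁻¹ + z.2⁻¹))‖ ^ 2 := by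
    intro a b
    have : ∑ z ∈ U ×ˢ U, ψ (a * (z.1 + z.2) + b * (z.1⁻¹ + z.2⁻¹)) =
        kloostermanSum ψ U a b * kloostermanSum ψ U a b := by
      rw [kloostermanSum, sum_mul_sum, sum_product]
      refine sum_congr rfl fun i _ => sum_congr rfl fun j _ => ?_
      rw [← AddChar.map_add_eq_mul]; congr 1; ring
    rw [this, norm_mul]; ring
  simp_rw [h1]
  rw [sum_normSq_expSum hψ (U ×ˢ U) (fun z => z.1 + z.2) (fun z => z.1⁻¹ + z.2⁻¹)]
  have hc : #{z ∈ (U ×ˢ U) ×ˢ (U ×ˢ U) | z.1.1 + z.1.2 = z.2.1 + z.2.2 ∧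
      z.1.1⁻¹ + z.1.2⁻¹ = z.2.1⁻¹ + z.2.2⁻¹} ≤ 3 * #U ^ 2 := by
    have hsub : {z ∈ (U ×ˢ U) ×ˢ (U ×ˢ U) | z.1.1 + z.1.2 = z.2.1 + z.2.2 ∧
      z.1.1⁻¹ + z.1.2⁻¹ = z.2.1⁻¹ + z.2.2⁻¹} ⊆
        ((U ×ˢ U).image fun w => ((w.1, w.2), (w.1, w.2))) ∪
        (((U ×ˢ U).image fun w => ((w.1, w.2), (w.2, w.1))) ∪
        ((U ×ˢ U).image fun w => ((w.1, -w.1), (w.2, -w.2)))) := by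
      rintro ⟨⟨x, y⟩, ⟨u, v⟩⟩ h
      simp only [mem_filter, mem_product] at h
      obtain ⟨⟨⟨hx, hy⟩, hu, hv⟩, hs, hi⟩ := h
      have hx0 := hU x hx
      have hy0 := hU y hy
      have hu0 := hU u hu
      have hv0 := hU v hv
      simp only [mem_union, mem_image, mem_product, Prod.exists, Prod.mk.injEq]
      by_cases h0 : x + y = 0
      · right; right
        exact ⟨x, u, ⟨hx, hu⟩, ⟨rfl, by linear_combination -h0⟩, rfl,
          by linear_combination hs - h0⟩
      · have hm : (x + y) * (u * v - x * y) = 0 := by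
          field_simp at hi
          linear_combination hi - (x * y) * hs
        have hm' : u * v = x * y := by
          rcases mul_eq_zero.1 hm with h | h
          · exact absurd h h0
          · exact sub_eq_zero.1 h
        have : (u - x) * (u - y) = 0 := by
          linear_combination -hm' - u * hs
        rcases mul_eq_zero.1 this with h | h
        · left
          have hux : u = x := sub_eq_zero.1 h
          exact ⟨x, y, ⟨hx, hy⟩, ⟨rfl, rfl⟩, hux.symm, by linear_combination hs + h⟩
        · right; left
          have hux : u = y := sub_eq_zero.1 h
          exact ⟨x, y, ⟨hx, hy⟩, ⟨rfl, rfl⟩, hux.symm, by linear_combination hs + h⟩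
    refine (card_le_card hsub).trans ((card_union_le _ _).trans ?_)
    have hcu := card_union_le ((U ×ˢ U).image fun w => ((w.1, w.2), (w.2, w.1)))
        ((U ×ˢ U).image fun w => ((w.1, -w.1), (w.2, -w.2)))
    have e1 := card_image_le (s := U ×ˢ U) (f := fun w => ((w.1, w.2), (w.1, w.2)))
    have e2 := card_image_le (s := U ×ˢ U) (f := fun w => ((w.1, w.2), (w.2, w.1)))
    have e3 := card_image_le (s := U ×ˢ U) (f := fun w => ((w.1, -w.1), (w.2, -w.2)))
    have e4 : #(U ×ˢ U) = #U ^ 2 := by rw [card_product, sq]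
    omega
  have hc' : (#{z ∈ (U ×ˢ U) ×ˢ (U ×ˢ U) | z.1.1 + z.1.2 = z.2.1 + z.2.2 ∧
      z.1.1⁻¹ + z.1.2⁻¹ = z.2.1⁻¹ + z.2.2⁻¹} : ℝ) ≤ 3 * (#U : ℝ) ^ 2 := by exact_mod_cast hc
  nlinarith [mul_le_mul_of_nonneg_left hc' (sq_nonneg (Fintype.card F : ℝ))]

theorem kloostermanSum_smul (ψ : AddChar F ℂ) {U : Finset F} {t : F} (ht : t ≠ 0)
    (htU : ∀ x ∈ U, t * x ∈ U) (a b : F) :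
    kloostermanSum ψ U (t * a) (t⁻¹ * b) = kloostermanSum ψ U a b := by
  have himg : U.image (t * ·) = U := by
    refine eq_of_subset_of_card_le (fun y hy => ?_) ?_
    · obtain ⟨x, hx, rfl⟩ := mem_image.1 hy
      exact htU x hx
    · rw [card_image_of_injective _ (mul_right_injective₀ ht)]
  unfold kloostermanSum
  conv_rhs => rw [← himg]
  rw [sum_image fun x _ y _ h => mul_right_injective₀ ht h]
  refine sum_congr rfl fun x _ => ?_
  congr 1
  rw [mul_inv]; ring

theorem card_mul_kloostermanSum_pow_four_le {ψ : AddChar F ℂ} (hψ : ψ.IsPrimitive)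
    {U H : Finset F} (hU : ∀ x ∈ U, x ≠ 0) (hH : ∀ t ∈ H, t ≠ 0)
    (hHU : ∀ t ∈ H, ∀ x ∈ U, t * x ∈ U) {a b : F} (hab : (a, b) ≠ (0, 0)) :
    (#H : ℝ) * ‖kloostermanSum ψ U a b‖ ^ 4 ≤
      3 * (Fintype.card F : ℝ) ^ 2 * (#U : ℝ) ^ 2 := by
  refine le_trans ?_ (sum_kloostermanSum_pow_four_le hψ hU)
  have hinj : Set.InjOn (fun t => (t * a, t⁻¹ * b)) (H : Set F) := by
    intro s hs t ht h
    simp only [Prod.mk.injEq] at h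
    by_cases ha : a = 0
    · have hb : b ≠ 0 := by rintro rfl; exact hab (by rw [ha])
      exact inv_injective (mul_right_cancel₀ hb h.2)
    · exact mul_right_cancel₀ ha h.1
  calc (#H : ℝ) * ‖kloostermanSum ψ U a b‖ ^ 4
      = ∑ t ∈ H, ‖kloostermanSum ψ U (t * a) (t⁻¹ * b)‖ ^ 4 := by
        rw [sum_congr rfl fun t ht => by
          rw [kloostermanSum_smul ψ (hH t ht) (hHU t ht)], sum_const, nsmul_eq_mul]
    _ = ∑ w ∈ H.image (fun t => (t * a, t⁻¹ * b)), ‖kloostermanSum ψ U w.1 w.2‖ ^ 4 := by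
        rw [sum_image hinj]
    _ ≤ ∑ w : F × F, ‖kloostermanSum ψ U w.1 w.2‖ ^ 4 :=
        sum_le_sum_of_subset_of_nonneg (subset_univ _) fun _ _ _ => by positivity
    _ = _ := by rw [Fintype.sum_prod_type]

/-- `f` has a Fourier expansion with constant coefficient `c₀` and coefficients of
`ℓ¹`-norm at most `L`. -/
def HasFourier (ψ : AddChar F ℂ) (f : F → ℝ) (c₀ L : ℝ) : Prop :=
  ∃ c : F → ℂ, (∀ x, (f x : ℂ) = ∑ a, c a * ψ (a * x)) ∧ c 0 = c₀ ∧ ∑ a, ‖c a‖ ≤ L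

theorem HasFourier.sub {ψ : AddChar F ℂ} {f g : F → ℝ} {c d L M : ℝ}
    (hf : HasFourier ψ f c L) (hg : HasFourier ψ g d M) :
    HasFourier ψ (fun x => f x - g x) (c - d) (L + M) := by
  obtain ⟨u, hu, hu0, huL⟩ := hf
  obtain ⟨v, hv, hv0, hvL⟩ := hg
  refine ⟨fun a => u a - v a, fun x => ?_, by simp [hu0, hv0], ?_⟩
  · push_cast
    rw [hu, hv, ← sum_sub_distrib]
    simp_rw [sub_mul]
  · refine le_trans (sum_le_sum fun a _ => norm_sub_le _ _) ?_
    rw [sum_add_distrib]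
    linarith

theorem HasFourier.indicator_addSubgroup {ψ : AddChar F ℂ} (hψ : ψ.IsPrimitive)
    (V : AddSubgroup F) [DecidablePred (· ∈ V)] :
    HasFourier ψ (fun x => if x ∈ V then 1 else 0)
      (Nat.card V / Fintype.card F : ℝ) 1 := by
  have hQ : (Fintype.card F : ℂ) ≠ 0 := by exact_mod_cast Fintype.card_ne_zero
  have hQ' : (0 : ℝ) < Fintype.card F := by exact_mod_cast Fintype.card_pos
  set d : F → ℝ := fun a => if ∀ y ∈ V, ψ (a * y) = 1 then
    (Nat.card V / Fintype.card F : ℝ) else 0 with hd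
  have hd0 : ∀ a, 0 ≤ d a := by
    intro a; simp only [hd]; split_ifs <;> positivity
  have hsumV : ∀ a, ∑ y : V, ψ (-(a * y)) = Fintype.card F * d a := by
    intro a
    let χ : AddChar V ℂ := ⟨fun y => ψ (-(a * y)), by simp, fun y z => by
      rw [← AddChar.map_add_eq_mul]; congr 1; push_cast; ring⟩
    have h := AddChar.sum_eq_ite χ
    have hχ : χ = 0 ↔ ∀ y ∈ V, ψ (a * y) = 1 := by
      constructor
      · intro h y hy
        have := DFunLike.congr_fun h ⟨-y, V.neg_mem hy⟩
        simpa [χ] using this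
      · intro h
        ext y
        have := h (-y) (V.neg_mem y.2)
        simpa [χ] using this
    have h' : ∑ y : V, ψ (-(a * y)) = ∑ y, χ y := rfl
    rw [h', h]
    simp only [hχ, hd]
    split_ifs
    · rw [Nat.card_eq_fintype_card]; push_cast; field_simp
    · simp
  have hexp : ∀ x, ((if x ∈ V then (1 : ℝ) else 0 : ℝ) : ℂ) = ∑ a, (d a : ℂ) * ψ (a * x) := by
    intro x
    have h1 : ∀ a, (d a : ℂ) = (∑ y : V, ψ (-(a * y))) / Fintype.card F := by
      intro a; rw [hsumV]; field_simp
    simp_rw [h1, div_mul_eq_mul_div, sum_mul]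
    rw [← sum_div, sum_comm]
    have h2 : ∀ y : V, ∑ a : F, ψ (-(a * (y : F))) * ψ (a * x) =
        if x - y = 0 then (Fintype.card F : ℂ) else 0 := by
      intro y
      have h3 := AddChar.sum_mulShift (x - y : F) hψ
      push_cast at h3
      rw [← h3]
      refine sum_congr rfl fun a _ => ?_
      rw [← AddChar.map_add_eq_mul]; congr 1; ring
    simp_rw [h2, sub_eq_zero]
    by_cases hx : x ∈ V
    · rw [sum_eq_single (⟨x, hx⟩ : V)]
      · simp [hx]
      · intro y _ hy
        rw [if_neg]
        rintro rfl
        exact hy rfl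
      · simp
    · rw [sum_eq_zero]
      · simp [hx]
      · intro y _
        rw [if_neg]
        rintro rfl
        exact hx y.2
  refine ⟨fun a => d a, hexp, ?_, ?_⟩
  · simp [hd]
  · have h0 := hexp 0
    simp only [V.zero_mem, if_true, mul_zero, AddChar.map_zero_eq_one, mul_one] at h0
    have : ∑ a, ‖(d a : ℂ)‖ = ∑ a, d a :=
      sum_congr rfl fun a _ => by rw [Complex.norm_real, Real.norm_of_nonneg (hd0 a)]
    rw [this]
    exact le_of_eq (by exact_mod_cast h0.symm)

theorem HasFourier.abs_sum_sub_le {ψ : AddChar F ℂ} {f g : F → ℝ} {c d L M E : ℝ}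
    (hf : HasFourier ψ f c L) (hg : HasFourier ψ g d M) {U : Finset F} (hE0 : 0 ≤ E)
    (hE : ∀ a b : F, (a, b) ≠ (0, 0) → ‖kloostermanSum ψ U a b‖ ≤ E) :
    |∑ x ∈ U, f x * g x⁻¹ - #U * c * d| ≤ L * M * E := by
  classical
  obtain ⟨u, hu, hu0, huL⟩ := hf
  obtain ⟨v, hv, hv0, hvL⟩ := hg
  have hexp : ((∑ x ∈ U, f x * g x⁻¹ : ℝ) : ℂ) =
      ∑ w : F × F, u w.1 * v w.2 * kloostermanSum ψ U w.1 w.2 := by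
    push_cast
    simp_rw [hu, hv, sum_mul_sum, kloostermanSum, mul_sum]
    rw [sum_comm, Fintype.sum_prod_type]
    refine sum_congr rfl fun a _ => ?_
    rw [sum_comm]
    refine sum_congr rfl fun b _ => sum_congr rfl fun x _ => ?_
    rw [AddChar.map_add_eq_mul]; ring
  have h00 : kloostermanSum ψ U 0 0 = #U := by simp [kloostermanSum]
  have hdiff : ((∑ x ∈ U, f x * g x⁻¹ - #U * c * d : ℝ) : ℂ) =
      ∑ w ∈ univ.erase ((0, 0) : F × F), u w.1 * v w.2 * kloostermanSum ψ U w.1 w.2 := by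
    rw [Complex.ofReal_sub, hexp, ← add_sum_erase univ _ (mem_univ ((0, 0) : F × F)), hu0, hv0, h00]
    push_cast; ring
  rw [← Real.norm_eq_abs, ← Complex.norm_real, hdiff]
  calc _ ≤ ∑ w ∈ univ.erase ((0, 0) : F × F), ‖u w.1‖ * ‖v w.2‖ * E := by
        refine norm_sum_le_of_le _ fun w hw => ?_
        rw [norm_mul, norm_mul]
        exact mul_le_mul_of_nonneg_left (hE _ _ (ne_of_mem_erase hw)) (by positivity)
    _ ≤ ∑ w : F × F, ‖u w.1‖ * ‖v w.2‖ * E :=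
        sum_le_sum_of_subset_of_nonneg (erase_subset _ _) fun _ _ _ => by positivity
    _ = (∑ a, ‖u a‖) * (∑ b, ‖v b‖) * E := by
        rw [← sum_mul, sum_mul_sum, Fintype.sum_prod_type]
    _ ≤ L * M * E := by
        refine mul_le_mul_of_nonneg_right (mul_le_mul huL hvL ?_ ?_) hE0
        · exact sum_nonneg fun _ _ => norm_nonneg _
        · exact le_trans (sum_nonneg fun _ _ => norm_nonneg _) huL

end Kloosterman

section PolyAction

variable {Fq F : Type*} [Field Fq] [Field F] [Fintype Fq] [Algebra Fq F]

/-- A polynomial over `Fq` acting on `F` through the Frobenius endomorphism. -/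
def frobAct (Fq F : Type*) [Field Fq] [Field F] [Fintype Fq] [Algebra Fq F] (h : Fq[X]) :
    F →ₗ[Fq] F :=
  aeval (FiniteField.frobeniusAlgHom Fq F).toLinearMap h

theorem frobAct_mul_apply (h k : Fq[X]) (β : F) :
    frobAct Fq F (h * k) β = frobAct Fq F h (frobAct Fq F k β) := by
  simp [frobAct]

theorem frobAct_add_apply (h k : Fq[X]) (β : F) :
    frobAct Fq F (h + k) β = frobAct Fq F h β + frobAct Fq F k β := by
  simp [frobAct]

theorem frobeniusAlgHom_pow_apply (i : ℕ) (β : F) :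
    ((FiniteField.frobeniusAlgHom Fq F).toLinearMap ^ i) β = β ^ Fintype.card Fq ^ i := by
  induction i with
  | zero => simp
  | succ i ih =>
    rw [pow_succ', Module.End.mul_apply, ih, pow_succ, pow_mul]
    simp

theorem polyAct_eq_frobAct (h : Fq[X]) (β : F) :
    polyAct (Fintype.card Fq) h β = frobAct Fq F h β := by
  rw [polyAct, frobAct, aeval_eq_sum_range, Polynomial.sum_over_range _ (by simp)]
  simp only [LinearMap.sum_apply, LinearMap.smul_apply, frobeniusAlgHom_pow_apply]
  simp only [Algebra.smul_def]

theorem frobAct_eq_zero_of_dvd {h k : Fq[X]} (hk : h ∣ k) {β : F} (hβ : frobAct Fq F h β = 0) :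
    frobAct Fq F k β = 0 := by
  obtain ⟨r, rfl⟩ := hk
  rw [mul_comm, frobAct_mul_apply, hβ, map_zero]

theorem frobAct_gcd_eq_zero [DecidableEq Fq] {h k : Fq[X]} {β : F} (hh : frobAct Fq F h β = 0)
    (hk : frobAct Fq F k β = 0) : frobAct Fq F (EuclideanDomain.gcd h k) β = 0 := by
  rw [EuclideanDomain.gcd_eq_gcd_ab, frobAct_add_apply,
    frobAct_eq_zero_of_dvd (dvd_mul_right _ _) hh, frobAct_eq_zero_of_dvd (dvd_mul_right _ _) hk,
    add_zero]

variable [Fintype F]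

theorem frobAct_X_pow_sub_one {n : ℕ} (hdim : Module.finrank Fq F = n) (β : F) :
    frobAct Fq F (X ^ n - 1) β = 0 := by
  have hcardF : Fintype.card F = Fintype.card Fq ^ n := by
    rw [← hdim]; exact Module.card_eq_pow_finrank
  have : frobAct Fq F (X ^ n - 1) β = β ^ Fintype.card Fq ^ n - β := by
    rw [← frobeniusAlgHom_pow_apply]
    simp [frobAct]
  rw [this, ← hcardF, FiniteField.pow_card, sub_self]

theorem card_ker_frobAct_le {h : Fq[X]} (h0 : h ≠ 0) :
    Nat.card (LinearMap.ker (frobAct Fq F h)) ≤ Fintype.card Fq ^ h.natDegree := by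
  classical
  have hq1 : 1 < Fintype.card Fq := Fintype.one_lt_card
  set L : F[X] := ∑ i ∈ Finset.range (h.natDegree + 1),
    C (algebraMap Fq F (h.coeff i)) * X ^ Fintype.card Fq ^ i with hL
  have hcoeff : L.coeff (Fintype.card Fq ^ h.natDegree) =
      algebraMap Fq F h.leadingCoeff := by
    rw [hL, finsetSum_coeff, Finset.sum_eq_single h.natDegree]
    · simp
    · intro i _ hi
      rw [coeff_C_mul_X_pow, if_neg]
      intro h'
      exact hi (Nat.pow_right_injective hq1 h').symm
    · simp
  have hL0 : L ≠ 0 := by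
    intro h'
    rw [h', coeff_zero] at hcoeff
    exact h0 (leadingCoeff_eq_zero.1 ((map_eq_zero _).1 hcoeff.symm))
  have hdeg : L.natDegree ≤ Fintype.card Fq ^ h.natDegree := by
    refine natDegree_sum_le_of_forall_le _ _ fun i hi => ?_
    refine (natDegree_C_mul_X_pow_le _ _).trans ?_
    exact Nat.pow_le_pow_right hq1.le (Nat.lt_succ_iff.1 (Finset.mem_range.1 hi))
  have hroot : ∀ β, frobAct Fq F h β = L.eval β := by
    intro β
    rw [frobAct, aeval_eq_sum_range, hL, eval_finsetSum]
    simp only [LinearMap.sum_apply, LinearMap.smul_apply, frobeniusAlgHom_pow_apply]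
    simp only [Algebra.smul_def, eval_mul, eval_C, eval_pow, eval_X]
  calc Nat.card (LinearMap.ker (frobAct Fq F h))
      = (Finset.univ.filter fun β : F => frobAct Fq F h β = 0).card := by
        rw [Nat.card_eq_fintype_card, Fintype.card_subtype]
        simp only [LinearMap.mem_ker]
    _ ≤ L.roots.toFinset.card := by
        refine Finset.card_le_card fun β hβ => ?_
        rw [Multiset.mem_toFinset, mem_roots hL0, IsRoot, ← hroot]
        exact (Finset.mem_filter.1 hβ).2
    _ ≤ _ := (Multiset.toFinset_card_le _).trans ((card_roots' L).trans hdeg)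

theorem card_ker_frobAct {n : ℕ} (hn : 0 < n) (hdim : Module.finrank Fq F = n) {h : Fq[X]}
    (hd : h ∣ X ^ n - 1) :
    Nat.card (LinearMap.ker (frobAct Fq F h)) = Fintype.card Fq ^ h.natDegree := by
  have hX : (X ^ n - 1 : Fq[X]) ≠ 0 := X_pow_sub_C_ne_zero hn 1
  obtain ⟨k, hk⟩ := hd
  have h0 : h ≠ 0 := by rintro rfl; exact hX (by rw [hk, zero_mul])
  have k0 : k ≠ 0 := by rintro rfl; exact hX (by rw [hk, mul_zero])
  refine le_antisymm (card_ker_frobAct_le h0) ?_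
  have hrange : LinearMap.range (frobAct Fq F k) ≤ LinearMap.ker (frobAct Fq F h) := by
    rintro _ ⟨β, rfl⟩
    rw [LinearMap.mem_ker, ← frobAct_mul_apply, ← hk, frobAct_X_pow_sub_one hdim]
  have hr := Submodule.finrank_mono hrange
  have hrn := LinearMap.finrank_range_add_finrank_ker (frobAct Fq F k)
  have hq1 : 1 < Fintype.card Fq := Fintype.one_lt_card
  have hkk := card_ker_frobAct_le (F := F) k0
  have hck : Nat.card (LinearMap.ker (frobAct Fq F k)) =
      Fintype.card Fq ^ Module.finrank Fq (LinearMap.ker (frobAct Fq F k)) := by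
    rw [Module.natCard_eq_pow_finrank (K := Fq), Nat.card_eq_fintype_card]
  have hch : Nat.card (LinearMap.ker (frobAct Fq F h)) =
      Fintype.card Fq ^ Module.finrank Fq (LinearMap.ker (frobAct Fq F h)) := by
    rw [Module.natCard_eq_pow_finrank (K := Fq), Nat.card_eq_fintype_card]
  rw [hck] at hkk
  have hkk' := (Nat.pow_le_pow_iff_right hq1).1 hkk
  rw [hch]
  refine Nat.pow_le_pow_right hq1.le ?_
  have hdeg : n = h.natDegree + k.natDegree := by
    rw [← natDegree_mul h0 k0, ← hk, ← C_1, natDegree_X_pow_sub_C]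
  omega

end PolyAction

theorem Polynomial.div_eq_of_eq_mul {K : Type*} [Field K] {f g h : K[X]} (hg : g ≠ 0)
    (h' : f = g * h) : f / g = h := by
  rw [h', mul_div_cancel_left₀ _ hg]

section OneNormal

variable {Fq F : Type*} [Field Fq] [Field F] [Fintype Fq] [Algebra Fq F]

open UniqueFactorizationMonoid in
/-- The monic irreducible factors of `1 + X + ⋯ + X ^ (n - 1)`. -/
def geomFactors (Fq : Type*) [Field Fq] (n : ℕ) : Finset Fq[X] := by
  classical exact (normalizedFactors (∑ i ∈ Finset.range n, X ^ i : Fq[X])).toFinset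

/-- The polynomial `1 + X + ⋯ + X ^ (n - 1)`. -/
def geomPoly (Fq : Type*) [Field Fq] (n : ℕ) : Fq[X] := ∑ i ∈ Finset.range n, X ^ i

theorem geomPoly_mul (n : ℕ) : geomPoly Fq n * (X - 1) = X ^ n - 1 := geom_sum_mul X n

theorem geomPoly_monic {n : ℕ} (hn : 0 < n) : (geomPoly Fq n).Monic :=
  monic_geom_sum_X hn.ne'

theorem natDegree_geomPoly {n : ℕ} (hn : 0 < n) : (geomPoly Fq n).natDegree = n - 1 := by
  have h := congrArg natDegree (geomPoly_mul (Fq := Fq) n)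
  rw [← C_1, (geomPoly_monic hn).natDegree_mul (monic_X_sub_C 1), natDegree_X_sub_C,
    natDegree_X_pow_sub_C] at h
  omega

theorem mem_geomFactors {n : ℕ} (hn : 0 < n) {P : Fq[X]} :
    P ∈ geomFactors Fq n ↔ Irreducible P ∧ P.Monic ∧ P ∣ geomPoly Fq n := by
  classical
  have h0 : (∑ i ∈ Finset.range n, X ^ i : Fq[X]) ≠ 0 := (geomPoly_monic hn).ne_zero
  rw [geomFactors, Multiset.mem_toFinset,
    UniqueFactorizationMonoid.mem_normalizedFactors_iff' h0]
  constructor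
  · rintro ⟨h1, h2, h3⟩
    exact ⟨h1, by rw [← h2]; exact monic_normalize h1.ne_zero, h3⟩
  · rintro ⟨h1, h2, h3⟩
    exact ⟨h1, h2.normalize_eq_self, h3⟩

theorem prod_dvd_geomPoly {n : ℕ} (hn : 0 < n) {T : Finset Fq[X]} (hT : T ⊆ geomFactors Fq n) :
    ∏ P ∈ T, P ∣ geomPoly Fq n := by
  refine Finset.prod_dvd_of_coprime (fun P hP R hR hne => ?_) fun P hP =>
    ((mem_geomFactors hn).1 (hT hP)).2.2
  have h1 := (mem_geomFactors hn).1 (hT hP)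
  have h2 := (mem_geomFactors hn).1 (hT hR)
  refine (Irreducible.coprime_iff_not_dvd h1.1).2 fun hd => hne ?_
  exact eq_of_monic_of_associated h1.2.1 h2.2.1 (h1.1.associated_of_dvd h2.1 hd)

theorem isCoprime_prod_geomFactors {n : ℕ} (hn : 0 < n) {T : Finset Fq[X]}
    (hT : T ⊆ geomFactors Fq n) {P : Fq[X]} (hP : P ∈ geomFactors Fq n) (hPT : P ∉ T) :
    IsCoprime P (∏ R ∈ T, R) := by
  refine IsCoprime.prod_right fun R hR => ?_
  have h1 := (mem_geomFactors hn).1 hP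
  have h2 := (mem_geomFactors hn).1 (hT hR)
  refine (Irreducible.coprime_iff_not_dvd h1.1).2 fun hd => hPT ?_
  rwa [eq_of_monic_of_associated h1.2.1 h2.2.1 (h1.1.associated_of_dvd h2.1 hd)]

theorem isKNormal_one_of_forall {n : ℕ} (hn : 0 < n) {α : F}
    (hα : frobAct Fq F (geomPoly Fq n) α = 0)
    (h : ∀ P ∈ geomFactors Fq n, frobAct Fq F (geomPoly Fq n / P) α ≠ 0) :
    IsKNormal Fq (Fintype.card Fq) n 1 α := by
  classical
  refine ⟨geomPoly Fq n, ⟨geomPoly_monic hn, ⟨X - 1, (geomPoly_mul n).symm⟩, ?_, ?_⟩,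
    natDegree_geomPoly hn⟩
  · rw [polyAct_eq_frobAct, hα]
  · intro k hk _ hkα
    rw [polyAct_eq_frobAct] at hkα
    by_contra! hlt
    have hd := frobAct_gcd_eq_zero hkα hα
    set d := EuclideanDomain.gcd k (geomPoly Fq n)
    have hdk : d.natDegree ≤ k.natDegree :=
      natDegree_le_of_dvd (EuclideanDomain.gcd_dvd_left _ _) hk.ne_zero
    obtain ⟨e, he⟩ : d ∣ geomPoly Fq n := EuclideanDomain.gcd_dvd_right _ _
    have hg0 := (geomPoly_monic (Fq := Fq) hn).ne_zero
    have he0 : e ≠ 0 := by rintro rfl; exact hg0 (by rw [he, mul_zero])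
    have hd0 : d ≠ 0 := by intro h'; exact hg0 (by rw [he, h', zero_mul])
    have heu : ¬ IsUnit e := by
      intro hu
      have := natDegree_mul hd0 he0
      rw [← he, natDegree_eq_zero_of_isUnit hu] at this
      omega
    obtain ⟨P, hP, hPe⟩ := WfDvdMonoid.exists_irreducible_factor heu he0
    have hPm : normalize P ∣ e := (normalize_dvd_iff).2 hPe
    have hPi : Irreducible (normalize P) := (normalize_associated P).symm.irreducible hP
    have hmem : normalize P ∈ geomFactors Fq n :=
      (mem_geomFactors hn).2 ⟨hPi, monic_normalize hP.ne_zero, hPm.trans ⟨d, by rw [he, mul_comm]⟩⟩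
    refine h _ hmem (frobAct_eq_zero_of_dvd ?_ hd)
    obtain ⟨r, hr⟩ := hPm
    refine ⟨r, ?_⟩
    rw [he, hr]
    exact Polynomial.div_eq_of_eq_mul hPi.ne_zero (by ring)

/-- The elements killed by `g` and by every `g / P` with `P ∈ T`, where
`g = 1 + X + ⋯ + X ^ (n - 1)`. -/
def geomKer (Fq F : Type*) [Field Fq] [Field F] [Fintype Fq] [Algebra Fq F] (n : ℕ)
    (T : Finset Fq[X]) : AddSubgroup F :=
  (LinearMap.ker (frobAct Fq F (geomPoly Fq n / ∏ P ∈ T, P))).toAddSubgroup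

theorem mem_geomKer {n : ℕ} {T : Finset Fq[X]} {x : F} :
    x ∈ geomKer Fq F n T ↔ frobAct Fq F (geomPoly Fq n / ∏ P ∈ T, P) x = 0 := Iff.rfl

theorem mem_geomKer_insert [DecidableEq Fq[X]] {n : ℕ} (hn : 0 < n) {T : Finset Fq[X]}
    (hT : T ⊆ geomFactors Fq n) {P : Fq[X]} (hP : P ∈ geomFactors Fq n) (hPT : P ∉ T) {x : F} :
    x ∈ geomKer Fq F n (insert P T) ↔
      x ∈ geomKer Fq F n T ∧ frobAct Fq F (geomPoly Fq n / P) x = 0 := by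
  rw [mem_geomKer, mem_geomKer, Finset.prod_insert hPT]
  obtain ⟨k, hk⟩ := prod_dvd_geomPoly hn (Finset.insert_subset hP hT)
  rw [Finset.prod_insert hPT] at hk
  have hg0 := (geomPoly_monic (Fq := Fq) hn).ne_zero
  have hP0 : P ≠ 0 := by rintro rfl; exact hg0 (by rw [hk]; ring)
  have hR0 : ∏ R ∈ T, R ≠ 0 := by intro h; exact hg0 (by rw [hk, h]; ring)
  have e1 : geomPoly Fq n / (P * ∏ R ∈ T, R) = k :=
    Polynomial.div_eq_of_eq_mul (mul_ne_zero hP0 hR0) hk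
  have e2 : geomPoly Fq n / ∏ R ∈ T, R = P * k :=
    Polynomial.div_eq_of_eq_mul hR0 (by rw [hk]; ring)
  have e3 : geomPoly Fq n / P = (∏ R ∈ T, R) * k :=
    Polynomial.div_eq_of_eq_mul hP0 (by rw [hk]; ring)
  rw [e1, e2, e3]
  refine ⟨fun h => ⟨frobAct_eq_zero_of_dvd (dvd_mul_left _ _) h,
    frobAct_eq_zero_of_dvd (dvd_mul_left _ _) h⟩, fun ⟨h1, h2⟩ => ?_⟩
  obtain ⟨u, v, huv⟩ := isCoprime_prod_geomFactors hn hT hP hPT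
  have : k = u * (P * k) + v * ((∏ R ∈ T, R) * k) := by linear_combination -k * huv
  rw [this, frobAct_add_apply, frobAct_eq_zero_of_dvd (dvd_mul_left _ _) h1,
    frobAct_eq_zero_of_dvd (dvd_mul_left _ _) h2, add_zero]

variable [Fintype F]

theorem card_geomKer {n : ℕ} (hn : 0 < n) (hdim : Module.finrank Fq F = n) {T : Finset Fq[X]}
    (hT : T ⊆ geomFactors Fq n) :
    (Nat.card (geomKer Fq F n T) : ℝ) / Fintype.card F =
      1 / Fintype.card Fq * ∏ P ∈ T, (1 / (Fintype.card Fq : ℝ) ^ P.natDegree) := by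
  have hcardF : Fintype.card F = Fintype.card Fq ^ n := by
    rw [← hdim]; exact Module.card_eq_pow_finrank
  have hq : (Fintype.card Fq : ℝ) ≠ 0 := by exact_mod_cast Fintype.card_ne_zero
  obtain ⟨k, hk⟩ := prod_dvd_geomPoly hn hT
  have hg0 := (geomPoly_monic (Fq := Fq) hn).ne_zero
  have hR0 : ∏ R ∈ T, R ≠ 0 := by intro h; exact hg0 (by rw [hk, h]; ring)
  have hk0 : k ≠ 0 := by rintro rfl; exact hg0 (by rw [hk]; ring)
  have e2 : geomPoly Fq n / ∏ R ∈ T, R = k :=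
    Polynomial.div_eq_of_eq_mul hR0 hk
  have hc : Nat.card (geomKer Fq F n T) = Fintype.card Fq ^ k.natDegree := by
    have := card_ker_frobAct (F := F) hn hdim (h := k)
      ((Dvd.intro_left _ hk.symm).trans ⟨X - 1, (geomPoly_mul n).symm⟩)
    rw [← this, ← e2]
    rfl
  have hdeg : n = 1 + k.natDegree + ∑ P ∈ T, P.natDegree := by
    have h1 := natDegree_geomPoly (Fq := Fq) hn
    rw [hk, natDegree_mul hR0 hk0, natDegree_prod_of_monic _ _ fun P hP =>
      ((mem_geomFactors hn).1 (hT hP)).2.1] at h1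
    omega
  rw [hc, hcardF, Finset.prod_div_distrib, Finset.prod_const_one, Finset.prod_pow_eq_pow_sum]
  push_cast
  have hpow : (Fintype.card Fq : ℝ) ^ n = Fintype.card Fq * Fintype.card Fq ^ k.natDegree *
      Fintype.card Fq ^ ∑ P ∈ T, P.natDegree := by
    conv_lhs => rw [hdeg, pow_add, pow_add, pow_one]
  rw [hpow]
  field_simp

/-- The indicator function of the elements killed by `g` and by `g / P` for `P ∈ T`, but not by
`g / P` for `P ∈ S`. -/
def geomInd (Fq F : Type*) [Field Fq] [Field F] [Fintype Fq] [Algebra Fq F] (n : ℕ)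
    (S T : Finset Fq[X]) (x : F) : ℝ := by
  classical exact (if x ∈ geomKer Fq F n T then 1 else 0) *
    ∏ P ∈ S, (1 - if frobAct Fq F (geomPoly Fq n / P) x = 0 then 1 else 0)

theorem hasFourier_geomInd [DecidableEq F] {ψ : AddChar F ℂ} (hψ : ψ.IsPrimitive) {n : ℕ}
    (hn : 0 < n) (hdim : Module.finrank Fq F = n) (S : Finset Fq[X]) :
    ∀ T : Finset Fq[X], S ⊆ geomFactors Fq n → T ⊆ geomFactors Fq n → Disjoint S T →
    HasFourier ψ (geomInd Fq F n S T)
      (1 / Fintype.card Fq * (∏ P ∈ T, (1 / (Fintype.card Fq : ℝ) ^ P.natDegree)) *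
        ∏ P ∈ S, (1 - 1 / (Fintype.card Fq : ℝ) ^ P.natDegree)) (2 ^ S.card) := by
  classical
  induction S using Finset.induction_on with
  | empty =>
    intro T _ hT _
    have h := HasFourier.indicator_addSubgroup hψ (geomKer Fq F n T)
    rw [card_geomKer hn hdim hT] at h
    have hf : geomInd Fq F n ∅ T = fun x => if x ∈ geomKer Fq F n T then 1 else 0 := by
      ext x; simp [geomInd]
    rw [hf]
    simpa using h
  | insert P S hPS ih =>
    intro T hS hT hST
    have hP : P ∈ geomFactors Fq n := hS (Finset.mem_insert_self _ _)
    have hS' : S ⊆ geomFactors Fq n := fun R hR => hS (Finset.mem_insert_of_mem hR)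
    obtain ⟨hPT, hST'⟩ := Finset.disjoint_insert_left.1 hST
    have h := (ih T hS' hT hST').sub (ih (insert P T) hS' (Finset.insert_subset hP hT)
      (Finset.disjoint_insert_right.2 ⟨hPS, hST'⟩))
    convert h using 1
    · ext x
      simp only [geomInd, Finset.prod_insert hPS, mem_geomKer_insert hn hT hP hPT]
      by_cases h1 : x ∈ geomKer Fq F n T <;>
        by_cases h2 : frobAct Fq F (geomPoly Fq n / P) x = 0 <;> simp [h1, h2]
    · rw [Finset.prod_insert hPS, Finset.prod_insert hPT]; ring
    · rw [Finset.card_insert_of_notMem hPS]; ring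

theorem geomInd_nonneg {n : ℕ} (S T : Finset Fq[X]) (x : F) : 0 ≤ geomInd Fq F n S T x := by
  classical
  refine mul_nonneg (by split_ifs <;> norm_num) (Finset.prod_nonneg fun P _ => ?_)
  split_ifs <;> norm_num

end OneNormal

section Primitive

open Finset

variable {F : Type*} [Field F] [Fintype F] [DecidableEq F]

theorem card_filter_pow_eq_one {d : ℕ} (hd : d ∣ Fintype.card F - 1) :
    #{x : F | x ≠ 0 ∧ x ^ d = 1} = d := by
  have h := IsCyclic.card_powMonoidHom_ker Fˣ d
  rw [Nat.card_units, Nat.card_eq_fintype_card (α := F), Nat.gcd_eq_right hd] at h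
  refine Eq.trans ?_ h
  rw [Nat.card_eq_fintype_card, Fintype.card_subtype]
  symm
  refine card_bij (fun u _ => (u : F)) (fun u hu => ?_) (fun u _ v _ h => Units.ext h) ?_
  · rw [mem_filter] at hu ⊢
    refine ⟨mem_univ _, u.ne_zero, ?_⟩
    have := hu.2
    rw [MonoidHom.mem_ker, powMonoidHom_apply] at this
    simpa using congrArg Units.val this
  · intro x hx
    rw [mem_filter] at hx
    refine ⟨Units.mk0 x hx.2.1, ?_, rfl⟩
    rw [mem_filter, MonoidHom.mem_ker, powMonoidHom_apply]
    exact ⟨mem_univ _, Units.ext (by simpa using hx.2.2)⟩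

theorem prod_dvd_of_subset_primeFactors {N : ℕ} {T : Finset ℕ} (hT : T ⊆ N.primeFactors) :
    ∏ p ∈ T, p ∣ N :=
  (prod_dvd_prod_of_subset _ _ _ hT).trans (Nat.prod_primeFactors_dvd N)

theorem forall_pow_div_eq_one_iff {N : ℕ} {x : F} (hx : x ^ N = 1)
    (T : Finset ℕ) (hT : T ⊆ N.primeFactors) :
    (∀ p ∈ T, x ^ (N / p) = 1) ↔ x ^ (N / ∏ p ∈ T, p) = 1 := by
  induction T using Finset.induction_on with
  | empty => simp [hx]
  | insert p T hpT ih =>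
    have hT' : T ⊆ N.primeFactors := fun r hr => hT (mem_insert_of_mem hr)
    have hp := Nat.prime_of_mem_primeFactors (hT (mem_insert_self _ _))
    obtain ⟨k, hk⟩ := prod_dvd_of_subset_primeFactors hT
    have hN0 : N ≠ 0 := (Nat.mem_primeFactors.1 (hT (mem_insert_self _ _))).2.2
    rw [prod_insert hpT] at hk
    have hT0 : 0 < ∏ r ∈ T, r := prod_pos fun r hr => (Nat.prime_of_mem_primeFactors (hT' hr)).pos
    have hcop : Nat.Coprime p (∏ r ∈ T, r) := by
      refine Nat.Coprime.prod_right fun r hr => ?_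
      exact (Nat.coprime_primes hp (Nat.prime_of_mem_primeFactors (hT' hr))).2
        (by rintro rfl; exact hpT hr)
    rw [forall_mem_insert, ih hT', prod_insert hpT]
    have e1 : N / p = (∏ r ∈ T, r) * k :=
      Nat.div_eq_of_eq_mul_right hp.pos (by rw [hk]; ring)
    have e2 : N / ∏ r ∈ T, r = p * k :=
      Nat.div_eq_of_eq_mul_right hT0 (by rw [hk]; ring)
    have e3 : N / (p * ∏ r ∈ T, r) = k :=
      Nat.div_eq_of_eq_mul_right (Nat.mul_pos hp.pos hT0) hk
    rw [e1, e2, e3]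
    constructor
    · rintro ⟨h1, h2⟩
      have := (orderOf_dvd_iff_pow_eq_one).2 h1
      have h3 := Nat.dvd_gcd (orderOf_dvd_of_pow_eq_one h2) this
      rw [Nat.gcd_mul_right, hcop, one_mul] at h3
      exact orderOf_dvd_iff_pow_eq_one.1 h3
    · intro h
      rw [mul_comm _ k, mul_comm _ k, pow_mul, pow_mul, h]
      simp

/-- The nonzero `x` with `x ^ (N / p) = 1` for `p ∈ T` and `x ^ (N / p) ≠ 1` for `p ∈ S`, where
`N = |F| - 1`. -/
def powAvoid (F : Type*) [Field F] [Fintype F] [DecidableEq F] (S T : Finset ℕ) : Finset F :=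
  {x : F | x ≠ 0 ∧ (∀ p ∈ T, x ^ ((Fintype.card F - 1) / p) = 1) ∧
    ∀ p ∈ S, x ^ ((Fintype.card F - 1) / p) ≠ 1}

theorem mem_powAvoid {S T : Finset ℕ} {x : F} : x ∈ powAvoid F S T ↔
    x ≠ 0 ∧ (∀ p ∈ T, x ^ ((Fintype.card F - 1) / p) = 1) ∧
    ∀ p ∈ S, x ^ ((Fintype.card F - 1) / p) ≠ 1 := by
  simp [powAvoid]

theorem card_powAvoid (S : Finset ℕ) : ∀ T : Finset ℕ,
    S ⊆ (Fintype.card F - 1).primeFactors → T ⊆ (Fintype.card F - 1).primeFactors →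
    Disjoint S T → (#(powAvoid F S T) : ℝ) =
      (Fintype.card F - 1 : ℕ) * (∏ p ∈ T, (1 / p : ℝ)) * ∏ p ∈ S, (1 - 1 / p : ℝ) := by
  induction S using Finset.induction_on with
  | empty =>
    intro T _ hT _
    have h : powAvoid F ∅ T =
        ({x : F | x ≠ 0 ∧ x ^ ((Fintype.card F - 1) / ∏ p ∈ T, p) = 1} : Finset F) := by
      ext x
      rw [mem_powAvoid, mem_filter]
      simp only [mem_univ, true_and, notMem_empty, false_imp_iff, implies_true, and_true]
      refine and_congr_right fun hx => ?_
      exact forall_pow_div_eq_one_iff (FiniteField.pow_card_sub_one_eq_one x hx) T hT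
    have hd := prod_dvd_of_subset_primeFactors hT
    rw [h, card_filter_pow_eq_one (Nat.div_dvd_of_dvd hd), Nat.cast_div hd]
    · simp [prod_inv_distrib, div_eq_mul_inv]
    · have : 0 < ∏ r ∈ T, r := prod_pos fun r hr => (Nat.prime_of_mem_primeFactors (hT hr)).pos
      exact_mod_cast this.ne'
  | insert p S hpS ih =>
    intro T hS hT hST
    have hp := hS (mem_insert_self _ _)
    have hS' : S ⊆ (Fintype.card F - 1).primeFactors := fun r hr => hS (mem_insert_of_mem hr)
    obtain ⟨hpT, hST'⟩ := disjoint_insert_left.1 hST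
    have h1 := ih T hS' hT hST'
    have h2 := ih (insert p T) hS' (insert_subset hp hT) (disjoint_insert_right.2 ⟨hpS, hST'⟩)
    have h3 : #(powAvoid F S T) =
        #(powAvoid F S (insert p T)) + #(powAvoid F (insert p S) T) := by
      rw [← card_union_of_disjoint]
      · congr 1
        ext x
        simp only [mem_union, mem_powAvoid, forall_mem_insert]
        tauto
      · rw [disjoint_left]
        intro x hx hx'
        rw [mem_powAvoid, forall_mem_insert] at hx hx'
        exact hx'.2.2.1 hx.2.1.1
    have h3' : (#(powAvoid F S T) : ℝ) =
        #(powAvoid F S (insert p T)) + #(powAvoid F (insert p S) T) := by exact_mod_cast h3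
    rw [h1, h2, prod_insert hpT] at h3'
    rw [prod_insert hpS]
    linear_combination -h3'

theorem norm_kloostermanSum_powAvoid {ψ : AddChar F ℂ} (hψ : ψ.IsPrimitive) {S T : Finset ℕ}
    (hS : S ⊆ (Fintype.card F - 1).primeFactors) (hT : T ⊆ (Fintype.card F - 1).primeFactors)
    (hST : Disjoint S T) {a b : F} (hab : (a, b) ≠ (0, 0)) :
    ((Fintype.card F - 1 : ℕ) : ℝ) * ‖kloostermanSum ψ (powAvoid F S T) a b‖ ^ 4 ≤
      3 * (Fintype.card F : ℝ) ^ 2 * (#(powAvoid F S T) : ℝ) ^ 2 *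
        ((∏ p ∈ T, (p : ℝ)) * ∏ p ∈ S, (p : ℝ)) := by
  set N := Fintype.card F - 1
  have hTS : T ∪ S ⊆ N.primeFactors := union_subset hT hS
  have hd := prod_dvd_of_subset_primeFactors hTS
  have hpos : 0 < ∏ p ∈ T ∪ S, p :=
    prod_pos fun r hr => (Nat.prime_of_mem_primeFactors (hTS hr)).pos
  have h := card_mul_kloostermanSum_pow_four_le hψ (U := powAvoid F S T)
    (H := {x : F | x ≠ 0 ∧ x ^ (N / ∏ p ∈ T ∪ S, p) = 1})
    (fun x hx => (mem_powAvoid.1 hx).1) (fun t ht => (mem_filter.1 ht).2.1) ?_ hab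
  · rw [card_filter_pow_eq_one (Nat.div_dvd_of_dvd hd),
      Nat.cast_div hd (by exact_mod_cast hpos.ne'),
      div_mul_eq_mul_div, div_le_iff₀ (by exact_mod_cast hpos), prod_union hST.symm] at h
    push_cast at h
    exact h
  · intro t ht x hx
    rw [mem_filter] at ht
    have ht1 := (forall_pow_div_eq_one_iff (FiniteField.pow_card_sub_one_eq_one t ht.2.1) _ hTS).2
      ht.2.2
    rw [mem_powAvoid] at hx ⊢
    refine ⟨mul_ne_zero ht.2.1 hx.1, fun p hp => ?_, fun p hp => ?_⟩
    · rw [mul_pow, ht1 p (mem_union_left _ hp), one_mul]; exact hx.2.1 p hp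
    · rw [mul_pow, ht1 p (mem_union_right _ hp), one_mul]; exact hx.2.2 p hp

end Primitive

section Sieve

open Finset

variable {Fq F : Type*} [Field Fq] [Field F] [Fintype Fq] [Algebra Fq F] [Fintype F]

theorem geomInd_singleton {n : ℕ} (hn : 0 < n) (A : Finset Fq[X]) {P : Fq[X]}
    (hP : P ∈ geomFactors Fq n) (x : F) :
    (frobAct Fq F (geomPoly Fq n / P) x = 0 → geomInd Fq F n A {P} x = geomInd Fq F n A ∅ x) := by
  classical
  intro h
  have h1 := mem_geomKer_insert (F := F) hn (empty_subset _) hP (notMem_empty P) (x := x)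
  rw [insert_empty_eq] at h1
  simp only [geomInd, h1, h, and_true]

theorem geomInd_empty_ne_zero {n : ℕ} {A : Finset Fq[X]} {x : F}
    (h : geomInd Fq F n A ∅ x ≠ 0) : frobAct Fq F (geomPoly Fq n) x = 0 ∧
      ∀ P ∈ A, frobAct Fq F (geomPoly Fq n / P) x ≠ 0 := by
  classical
  obtain ⟨h1, h2⟩ := mul_ne_zero_iff.1 h
  constructor
  · have : x ∈ geomKer Fq F n ∅ := by by_contra h'; exact h1 (if_neg h')
    simpa [mem_geomKer] using this
  · intro P hP h'
    exact (prod_ne_zero_iff.1 h2) P hP (by simp [h'])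

variable [DecidableEq F] [DecidableEq Fq[X]]

theorem exists_primitive_pair_of_sieve {n : ℕ} (hn : 0 < n) (hdim : Module.finrank Fq F = n)
    {C : Finset ℕ} (hC : C ⊆ (Fintype.card F - 1).primeFactors)
    {A : Finset Fq[X]} (hA : A ⊆ geomFactors Fq n) {E : ℝ} (hE0 : 0 ≤ E)
    (hE : 3 * (Fintype.card F : ℝ) ^ 2 * (#(powAvoid F C ∅) : ℝ) ^ 2 * ∏ p ∈ C, (p : ℝ) ≤
      (Fintype.card F - 1 : ℕ) * E ^ 4)
    (hmain : 4 ^ #A * (1 + #((Fintype.card F - 1).primeFactors \ C) +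
        2 * #(geomFactors Fq n \ A)) * E <
      #(powAvoid F C ∅) * (1 / Fintype.card Fq *
        ∏ P ∈ A, (1 - 1 / (Fintype.card Fq : ℝ) ^ P.natDegree)) ^ 2 *
      (1 - ∑ p ∈ (Fintype.card F - 1).primeFactors \ C, (1 / p : ℝ) -
        2 * ∑ P ∈ geomFactors Fq n \ A, (1 / (Fintype.card Fq : ℝ) ^ P.natDegree))) :
    ∃ α : F, α ≠ 0 ∧ orderOf α = Fintype.card F - 1 ∧ IsKNormal Fq (Fintype.card Fq) n 1 α ∧
      IsKNormal Fq (Fintype.card Fq) n 1 α⁻¹ := by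
  obtain ⟨ψ, hψ⟩ : ∃ ψ : AddChar F ℂ, ψ.IsPrimitive :=
    ⟨AddChar.FiniteField.primitiveChar_to_Complex F,
      AddChar.FiniteField.primitiveChar_to_Complex_isPrimitive F⟩
  by_contra hno
  set N := Fintype.card F - 1 with hN
  have hN0 : 0 < N := Nat.sub_pos_of_lt Fintype.one_lt_card
  have hNR : (0 : ℝ) < N := by exact_mod_cast hN0
  set R := N.primeFactors \ C with hR
  set B := geomFactors Fq n \ A with hB
  set q : ℝ := (Fintype.card Fq : ℝ) with hq
  set δ : ℝ := 1 / q * ∏ P ∈ A, (1 - 1 / q ^ P.natDegree) with hδ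
  set f := geomInd Fq F n A ∅ with hf
  have hf0 : ∀ x, 0 ≤ f x := geomInd_nonneg _ _
  have hfour : ∀ T ⊆ B, HasFourier ψ (geomInd Fq F n A T)
      (δ * ∏ P ∈ T, (1 / q ^ P.natDegree)) (2 ^ #A) := by
    intro T hT
    have := hasFourier_geomInd hψ hn hdim A T hA (hT.trans sdiff_subset)
      (disjoint_sdiff.mono_right hT)
    convert this using 1
    rw [hδ]; ring
  have hfδ : HasFourier ψ f δ (2 ^ #A) := by simpa using hfour ∅ (empty_subset _)
  have hfP : ∀ P ∈ B, HasFourier ψ (geomInd Fq F n A {P}) (δ * (1 / q ^ P.natDegree)) (2 ^ #A) :=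
    fun P hP => by simpa using hfour {P} (singleton_subset_iff.2 hP)
  have h4 : (2 : ℝ) ^ #A * 2 ^ #A = 4 ^ #A := by rw [← mul_pow]; norm_num
  have hcard : (#(powAvoid F C ∅) : ℝ) = N * ∏ p ∈ C, (1 - 1 / p : ℝ) := by
    rw [card_powAvoid C ∅ hC (empty_subset _) (disjoint_empty_right _)]; simp [hN]
  have hcardp : ∀ p ∈ R, (#(powAvoid F C {p}) : ℝ) = #(powAvoid F C ∅) * (1 / p) := by
    intro p hp
    rw [mem_sdiff] at hp
    rw [card_powAvoid C {p} hC (singleton_subset_iff.2 hp.1) (disjoint_singleton_right.2 hp.2),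
      hcard]
    simp only [prod_singleton, hN]; ring
  have hKl : ∀ a b : F, (a, b) ≠ (0, 0) → ‖kloostermanSum ψ (powAvoid F C ∅) a b‖ ≤ E := by
    intro a b hab
    have h := norm_kloostermanSum_powAvoid hψ hC (empty_subset _) (disjoint_empty_right _) hab
    rw [prod_empty, one_mul] at h
    exact le_of_pow_le_pow_left₀ (by norm_num) hE0
      (le_of_mul_le_mul_left (h.trans hE) hNR)
  have hKlp : ∀ p ∈ R, ∀ a b : F, (a, b) ≠ (0, 0) →
      ‖kloostermanSum ψ (powAvoid F C {p}) a b‖ ≤ E := by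
    intro p hp a b hab
    have hp' := mem_sdiff.1 hp
    have hp1 : (1 : ℝ) ≤ p := by
      exact_mod_cast (Nat.prime_of_mem_primeFactors hp'.1).one_le
    have h := norm_kloostermanSum_powAvoid hψ hC (singleton_subset_iff.2 hp'.1)
      (disjoint_singleton_right.2 hp'.2) hab
    rw [prod_singleton, hcardp p hp] at h
    refine le_of_pow_le_pow_left₀ (by norm_num) hE0
      (le_of_mul_le_mul_left (h.trans (le_trans ?_ hE)) hNR)
    have hm : (0 : ℝ) ≤ ∏ p ∈ C, (p : ℝ) := prod_nonneg fun _ _ => Nat.cast_nonneg _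
    have e : 3 * (Fintype.card F : ℝ) ^ 2 * (#(powAvoid F C ∅) * (1 / p : ℝ)) ^ 2 *
        (p * ∏ p ∈ C, (p : ℝ)) = (3 * (Fintype.card F : ℝ) ^ 2 * (#(powAvoid F C ∅) : ℝ) ^ 2 *
          ∏ p ∈ C, (p : ℝ)) * (1 / p) := by
      have : (p : ℝ) ≠ 0 := by positivity
      field_simp
    rw [e]
    refine mul_le_of_le_one_right (by positivity) ?_
    rw [div_le_one (by positivity)]; exact hp1
  -- the sieve inequality when there is no such element
  have hpt : ∀ x ∈ powAvoid F C ∅, f x * f x⁻¹ ≤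
      ∑ p ∈ R, (if x ^ (N / p) = 1 then f x * f x⁻¹ else 0) +
      (∑ P ∈ B, geomInd Fq F n A {P} x * f x⁻¹ + ∑ P ∈ B, f x * geomInd Fq F n A {P} x⁻¹) := by
    intro x hx
    obtain ⟨hx0, -, hxC⟩ := mem_powAvoid.1 hx
    have n1 : ∀ p ∈ R, 0 ≤ (if x ^ (N / p) = 1 then f x * f x⁻¹ else 0) := by
      intro p _
      split_ifs
      · exact mul_nonneg (hf0 _) (hf0 _)
      · exact le_rfl
    have n2 : ∀ P ∈ B, 0 ≤ geomInd Fq F n A {P} x * f x⁻¹ :=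
      fun P _ => mul_nonneg (geomInd_nonneg _ _ _) (hf0 _)
    have n3 : ∀ P ∈ B, 0 ≤ f x * geomInd Fq F n A {P} x⁻¹ :=
      fun P _ => mul_nonneg (hf0 _) (geomInd_nonneg _ _ _)
    have s1 := sum_nonneg n1
    have s2 := sum_nonneg n2
    have s3 := sum_nonneg n3
    by_cases hw : f x * f x⁻¹ = 0
    · rw [hw] at s1 ⊢; simp only [hw] at *; linarith
    obtain ⟨hwx, hwy⟩ := mul_ne_zero_iff.1 hw
    by_cases c1 : ∃ p ∈ R, x ^ (N / p) = 1
    · obtain ⟨p, hp, hxp⟩ := c1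
      have := single_le_sum n1 hp
      rw [if_pos hxp] at this
      linarith
    by_cases c2 : ∃ P ∈ B, frobAct Fq F (geomPoly Fq n / P) x = 0
    · obtain ⟨P, hP, hxP⟩ := c2
      have := single_le_sum n2 hP
      rw [geomInd_singleton hn A (mem_sdiff.1 hP).1 x hxP] at this
      linarith
    by_cases c3 : ∃ P ∈ B, frobAct Fq F (geomPoly Fq n / P) x⁻¹ = 0
    · obtain ⟨P, hP, hxP⟩ := c3
      have := single_le_sum n3 hP
      rw [geomInd_singleton hn A (mem_sdiff.1 hP).1 _ hxP] at this
      linarith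
    push Not at c1 c2 c3
    exfalso
    refine hno ⟨x, hx0, ?_, ?_, ?_⟩
    · refine orderOf_eq_of_pow_and_pow_div_prime hN0
        (FiniteField.pow_card_sub_one_eq_one x hx0) fun p hp hpN => ?_
      have hmem : p ∈ N.primeFactors := Nat.mem_primeFactors.2 ⟨hp, hpN, hN0.ne'⟩
      by_cases hpC : p ∈ C
      · exact hxC p hpC
      · exact c1 p (mem_sdiff.2 ⟨hmem, hpC⟩)
    · have h := geomInd_empty_ne_zero hwx
      refine isKNormal_one_of_forall hn h.1 fun P hP => ?_
      by_cases hPA : P ∈ A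
      · exact h.2 P hPA
      · exact c2 P (mem_sdiff.2 ⟨hP, hPA⟩)
    · have h := geomInd_empty_ne_zero hwy
      refine isKNormal_one_of_forall hn h.1 fun P hP => ?_
      by_cases hPA : P ∈ A
      · exact h.2 P hPA
      · exact c3 P (mem_sdiff.2 ⟨hP, hPA⟩)
  have hsum := sum_le_sum hpt
  rw [sum_add_distrib, sum_add_distrib, sum_comm (t := R), sum_comm (t := B), sum_comm (t := B)]
    at hsum
  have b0 := (abs_le.1 (hfδ.abs_sum_sub_le hfδ hE0 hKl)).1
  have b1 : ∀ p ∈ R, ∑ x ∈ powAvoid F C ∅, (if x ^ (N / p) = 1 then f x * f x⁻¹ else 0) ≤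
      #(powAvoid F C ∅) * δ ^ 2 * (1 / p) + 4 ^ #A * E := by
    intro p hp
    have e : powAvoid F C {p} = (powAvoid F C ∅).filter fun x => x ^ (N / p) = 1 := by
      ext x
      simp only [mem_filter, mem_powAvoid, mem_singleton, forall_eq, notMem_empty, false_imp_iff,
        implies_true, true_and]
      tauto
    rw [← sum_filter, ← e]
    have := (abs_le.1 (hfδ.abs_sum_sub_le hfδ hE0 (hKlp p hp))).2
    rw [hcardp p hp, h4] at this
    linarith
  have b2 : ∀ P ∈ B, ∑ x ∈ powAvoid F C ∅, geomInd Fq F n A {P} x * f x⁻¹ ≤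
      #(powAvoid F C ∅) * δ ^ 2 * (1 / q ^ P.natDegree) + 4 ^ #A * E := by
    intro P hP
    have := (abs_le.1 ((hfP P hP).abs_sum_sub_le hfδ hE0 hKl)).2
    rw [h4] at this
    linarith
  have b3 : ∀ P ∈ B, ∑ x ∈ powAvoid F C ∅, f x * geomInd Fq F n A {P} x⁻¹ ≤
      #(powAvoid F C ∅) * δ ^ 2 * (1 / q ^ P.natDegree) + 4 ^ #A * E := by
    intro P hP
    have := (abs_le.1 (hfδ.abs_sum_sub_le (hfP P hP) hE0 hKl)).2
    rw [h4] at this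
    linarith
  have t1 := sum_le_sum b1
  have t2 := sum_le_sum b2
  have t3 := sum_le_sum b3
  rw [sum_add_distrib, ← mul_sum, sum_const, nsmul_eq_mul] at t1 t2 t3
  rw [h4] at b0
  linarith

end Sieve

section Bounds

open Finset

variable {Fq F : Type*} [Field Fq] [Field F] [Fintype Fq] [Algebra Fq F] [Fintype F]

theorem exists_primitive_pair_of_bounds {q n : ℕ} (hcard : Fintype.card Fq = q) (hn : 14 ≤ n)
    (hdim : Module.finrank Fq F = n) {C : Finset ℕ} (hC : C ⊆ (q ^ n - 1).primeFactors)
    (D m c k r : ℕ) {δC δA τ σ : ℝ}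
    (hm : ∏ p ∈ C, p ≤ m) (hδC0 : 0 < δC) (hδC : δC ≤ ∏ p ∈ C, (1 - 1 / p : ℝ))
    (hk : #((q ^ n - 1).primeFactors \ C) ≤ k)
    (hτ : ∑ p ∈ (q ^ n - 1).primeFactors \ C, (1 / p : ℝ) ≤ τ)
    (hc : #{P ∈ geomFactors Fq n | P.natDegree ≤ D} ≤ c) (hδA0 : 0 < δA)
    (hδA : δA ≤ ∏ P ∈ geomFactors Fq n with P.natDegree ≤ D, (1 - 1 / (q : ℝ) ^ P.natDegree))
    (hr : #{P ∈ geomFactors Fq n | D < P.natDegree} ≤ r)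
    (hσ : ∑ P ∈ geomFactors Fq n with D < P.natDegree, (1 / (q : ℝ) ^ P.natDegree) ≤ σ)
    (hρ : τ + 2 * σ < 1)
    (hmain : 24 * (q : ℝ) ^ 8 * 256 ^ c * (1 + k + 2 * r) ^ 4 * m <
      7 * q ^ n * δC ^ 2 * δA ^ 8 * (1 - τ - 2 * σ) ^ 4) :
    ∃ α : F, α ≠ 0 ∧ orderOf α = q ^ n - 1 ∧ IsKNormal Fq q n 1 α ∧ IsKNormal Fq q n 1 α⁻¹ := by
  classical
  have hcardF : Fintype.card F = q ^ n := by
    rw [← hdim, ← hcard]; exact Module.card_eq_pow_finrank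
  have hq2 : 2 ≤ q := by rw [← hcard]; exact Fintype.one_lt_card
  have hQ : 2 ^ 14 ≤ q ^ n :=
    (Nat.pow_le_pow_left hq2 14).trans (Nat.pow_le_pow_right (by omega) hn)
  set N := q ^ n - 1 with hN
  have hN1 : q ^ n = N + 1 := by omega
  have hQN : (q : ℝ) ^ n = N + 1 := by exact_mod_cast hN1
  have hNbig : (16383 : ℝ) ≤ N := by
    have : 16383 ≤ N := by omega
    exact_mod_cast this
  have hN0 : (0 : ℝ) < N := by linarith
  set A := {P ∈ geomFactors Fq n | P.natDegree ≤ D} with hA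
  have hB : geomFactors Fq n \ A = {P ∈ geomFactors Fq n | D < P.natDegree} := by
    ext P; simp only [hA, mem_sdiff, mem_filter, not_and, not_le]; tauto
  have hU : (#(powAvoid F C ∅) : ℝ) = N * ∏ p ∈ C, (1 - 1 / p : ℝ) := by
    rw [card_powAvoid C ∅ (by rwa [hcardF]) (empty_subset _) (disjoint_empty_right _), hcardF]
    simp [hN]
  set ΔC : ℝ := ∏ p ∈ C, (1 - 1 / p : ℝ)
  set ΔA : ℝ := ∏ P ∈ A, (1 - 1 / (q : ℝ) ^ P.natDegree)
  have hΔC : 0 < ΔC := hδC0.trans_le hδC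
  have hΔA : 0 < ΔA := hδA0.trans_le hδA
  set m' : ℝ := ∏ p ∈ C, (p : ℝ)
  have hm0 : 0 ≤ m' := prod_nonneg fun _ _ => Nat.cast_nonneg _
  have hm' : m' ≤ m := by
    have h : ((∏ p ∈ C, p : ℕ) : ℝ) ≤ m := by exact_mod_cast hm
    rwa [Nat.cast_prod] at h
  set y : ℝ := 3 * (N + 1) ^ 2 * (N * ΔC) ^ 2 * m' / N with hy
  have hy0 : 0 ≤ y := by positivity
  have hE4 : (√√y) ^ 4 = y := by
    rw [show (4 : ℕ) = 2 * 2 by norm_num, pow_mul, Real.sq_sqrt (Real.sqrt_nonneg _),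
      Real.sq_sqrt hy0]
  set τ' : ℝ := ∑ p ∈ N.primeFactors \ C, (1 / p : ℝ)
  set σ' : ℝ := ∑ P ∈ geomFactors Fq n with D < P.natDegree, (1 / (q : ℝ) ^ P.natDegree)
  have hq0 : (0 : ℝ) < q := by exact_mod_cast (by omega : 0 < q)
  have key := exists_primitive_pair_of_sieve (Fq := Fq) (F := F) (by omega : 0 < n) hdim (C := C)
    (by rwa [hcardF]) (A := A) (filter_subset _ _) (E := √√y) (Real.sqrt_nonneg _) ?_ ?_
  · rwa [hcardF, hcard] at key
  · rw [hU, hcardF, hE4, ← hN, hy]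
    push_cast
    rw [hQN]
    apply le_of_eq
    field_simp
    ring
  · rw [hU, hcardF, ← hN, hB, hcard]
    change _ < N * ΔC * (1 / q * ΔA) ^ 2 * (1 - τ' - 2 * σ')
    refine lt_of_pow_lt_pow_left₀ 4 ?_ ?_
    · have : 0 ≤ 1 - τ' - 2 * σ' := by linarith
      positivity
    set K' : ℝ := 1 + #(N.primeFactors \ C) + 2 * #{P ∈ geomFactors Fq n | D < P.natDegree}
    have hK' : K' ≤ 1 + k + 2 * r := by
      have h1 : (#(N.primeFactors \ C) : ℝ) ≤ k := by exact_mod_cast hk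
      have h2 : (#{P ∈ geomFactors Fq n | D < P.natDegree} : ℝ) ≤ r := by exact_mod_cast hr
      simp only [K']; linarith
    have hK0 : 0 ≤ K' := by
      have h1 : (0 : ℝ) ≤ #(N.primeFactors \ C) := Nat.cast_nonneg _
      have h2 : (0 : ℝ) ≤ #{P ∈ geomFactors Fq n | D < P.natDegree} := Nat.cast_nonneg _
      simp only [K']; linarith
    clear_value K' ΔA ΔC m' τ' σ'
    have e1 : (4 ^ #A * K' * √√y) ^ 4 = 256 ^ #A * K' ^ 4 * y := by
      rw [mul_pow, mul_pow, hE4, ← pow_mul, mul_comm (#A) 4, pow_mul,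
        show (4 : ℝ) ^ 4 = 256 by norm_num1]
    have e2 : 256 ^ #A * K' ^ 4 * y =
        (24 * q ^ 8 * 256 ^ #A * K' ^ 4 * m') * ((N + 1) ^ 2 * N * ΔC ^ 2 / (8 * q ^ 8)) := by
      rw [hy]; field_simp; ring
    have e3 : (N * ΔC * (1 / q * ΔA) ^ 2 * (1 - τ' - 2 * σ')) ^ 4 =
        (8 * N ^ 3 / (N + 1) ^ 2 * ΔC ^ 2 * ΔA ^ 8 * (1 - τ' - 2 * σ') ^ 4) *
          ((N + 1) ^ 2 * N * ΔC ^ 2 / (8 * q ^ 8)) := by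
      field_simp
    rw [e1, e2, e3]
    refine mul_lt_mul_of_pos_right ?_ (by positivity)
    calc 24 * (q : ℝ) ^ 8 * 256 ^ #A * K' ^ 4 * m'
        ≤ 24 * (q : ℝ) ^ 8 * 256 ^ c * (1 + k + 2 * r) ^ 4 * m := by
          gcongr
          exact (by norm_num1 : (1 : ℝ) ≤ 256)
      _ < 7 * q ^ n * δC ^ 2 * δA ^ 8 * (1 - τ - 2 * σ) ^ 4 := hmain
      _ ≤ (8 * N ^ 3 / (N + 1) ^ 2) * ΔC ^ 2 * ΔA ^ 8 * (1 - τ' - 2 * σ') ^ 4 := by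
          have h1 : 7 * (q : ℝ) ^ n ≤ 8 * N ^ 3 / (N + 1) ^ 2 := by
            rw [hQN, le_div_iff₀ (by positivity)]
            have a1 : 16383 * (N : ℝ) ≤ N ^ 2 := by rw [sq]; gcongr
            have a2 : 16383 * (N : ℝ) ^ 2 ≤ N ^ 3 := by
              rw [show (N : ℝ) ^ 3 = N * N ^ 2 by ring]; gcongr
            linarith [show 7 * ((N : ℝ) + 1) * (N + 1) ^ 2 =
              7 * (N : ℝ) ^ 3 + 21 * (N : ℝ) ^ 2 + 21 * N + 7 by ring]
          have h2 : 0 ≤ 1 - τ - 2 * σ := by linarith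
          gcongr

end Bounds

section FactorCount

open Finset

variable {Fq : Type*} [Field Fq] [Fintype Fq]

theorem natDegree_pos_of_mem_geomFactors {n : ℕ} (hn : 0 < n) {P : Fq[X]}
    (hP : P ∈ geomFactors Fq n) : 1 ≤ P.natDegree :=
  ((mem_geomFactors hn).1 hP).1.natDegree_pos

theorem sum_natDegree_le_of_prod_dvd {T : Finset Fq[X]} (hT : ∀ P ∈ T, P.Monic) {f : Fq[X]}
    (hf : f ≠ 0) (h : ∏ P ∈ T, P ∣ f) : ∑ P ∈ T, P.natDegree ≤ f.natDegree := by
  have := natDegree_le_of_dvd h hf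
  rwa [natDegree_prod_of_monic _ _ hT] at this

theorem isCoprime_of_irreducible_of_monic {P R : Fq[X]} (hP : Irreducible P) (hP' : P.Monic)
    (hR : Irreducible R) (hR' : R.Monic) (hne : P ≠ R) : IsCoprime P R :=
  (Irreducible.coprime_iff_not_dvd hP).2 fun hd =>
    hne (eq_of_monic_of_associated hP' hR' (hP.associated_of_dvd hR hd))

theorem dvd_X_pow_gcd_sub_one {n : ℕ} (hn : 0 < n) {P : Fq[X]} (hP : P ∈ geomFactors Fq n) :
    P ∣ (X ^ Nat.gcd n (Fintype.card Fq ^ P.natDegree - 1) - 1 : Fq[X]) := by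
  obtain ⟨h1, h2, h3⟩ := (mem_geomFactors hn).1 hP
  have hd1 : P ∣ (X ^ n - 1 : Fq[X]) := h3.trans ⟨X - 1, (geomPoly_mul n).symm⟩
  have hd2 : P ∣ (X ^ (Fintype.card Fq) ^ P.natDegree - X : Fq[X]) := by
    rw [← Nat.card_eq_fintype_card]
    exact (h1.natDegree_dvd_iff_dvd_X_pow_card_pow_sub_X).1 dvd_rfl
  have hq : 0 < Fintype.card Fq ^ P.natDegree := pow_pos Fintype.card_pos _
  have hd3 : P ∣ (X ^ (Fintype.card Fq ^ P.natDegree - 1) - 1 : Fq[X]) := by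
    have e : (X ^ (Fintype.card Fq) ^ P.natDegree - X : Fq[X]) =
        X * (X ^ (Fintype.card Fq ^ P.natDegree - 1) - 1) := by
      conv_lhs => rw [← Nat.sub_add_cancel hq, pow_succ]
      ring
    rw [e] at hd2
    refine (h1.prime.dvd_or_dvd hd2).resolve_left fun hX => ?_
    have hX1 : P ∣ (X ^ n : Fq[X]) := dvd_pow hX hn.ne'
    have : P ∣ (1 : Fq[X]) := by
      have := dvd_sub hX1 hd1
      rwa [sub_sub_cancel] at this
    exact h1.not_isUnit (isUnit_of_dvd_one this)
  have key : ∀ k : ℕ, P ∣ (X ^ k - 1 : Fq[X]) ↔ orderOf (AdjoinRoot.root P) ∣ k := by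
    intro k
    rw [orderOf_dvd_iff_pow_eq_one, ← sub_eq_zero, ← AdjoinRoot.mk_eq_zero]
    simp
  rw [key] at hd1 hd3 ⊢
  exact Nat.dvd_gcd hd1 hd3

theorem card_geomFactors_mul_le {n : ℕ} (hn : 0 < n) (d : ℕ) :
    #{P ∈ geomFactors Fq n | P.natDegree = d} * d ≤ Nat.gcd n (Fintype.card Fq ^ d - 1) := by
  have hpos : 0 < Nat.gcd n (Fintype.card Fq ^ d - 1) := Nat.gcd_pos_of_pos_left _ hn
  have hf : (X ^ Nat.gcd n (Fintype.card Fq ^ d - 1) - C 1 : Fq[X]) ≠ 0 :=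
    X_pow_sub_C_ne_zero hpos 1
  have h := sum_natDegree_le_of_prod_dvd (T := {P ∈ geomFactors Fq n | P.natDegree = d})
    (fun P hP => ((mem_geomFactors hn).1 (mem_filter.1 hP).1).2.1) hf ?_
  · rw [natDegree_X_pow_sub_C, sum_congr rfl fun P hP => (mem_filter.1 hP).2] at h
    simpa using h
  · refine Finset.prod_dvd_of_coprime (fun P hP R hR hne => ?_) fun P hP => ?_
    · have h1 := (mem_geomFactors hn).1 (mem_filter.1 hP).1
      have h2 := (mem_geomFactors hn).1 (mem_filter.1 hR).1
      exact isCoprime_of_irreducible_of_monic h1.1 h1.2.1 h2.1 h2.2.1 hne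
    · have := dvd_X_pow_gcd_sub_one hn (mem_filter.1 hP).1
      rwa [(mem_filter.1 hP).2] at this

theorem X_sub_one_notMem_geomFactors {n : ℕ} (hn : 0 < n) (h : (n : Fq) ≠ 0) :
    (X - C 1 : Fq[X]) ∉ geomFactors Fq n := by
  intro hP
  have h1 := ((mem_geomFactors hn).1 hP).2.2
  rw [dvd_iff_isRoot, IsRoot.def] at h1
  apply h
  have h2 := congrArg (fun f : Fq[X] => (derivative f).eval 1) (geomPoly_mul (Fq := Fq) n)
  simp [derivative_mul, h1, derivative_X_pow] at h2
  exact h2.symm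

theorem card_geomFactors_one_lt {n : ℕ} (hn : 0 < n) (h : (n : Fq) ≠ 0) :
    #{P ∈ geomFactors Fq n | P.natDegree = 1} < Nat.gcd n (Fintype.card Fq - 1) := by
  classical
  have hpos : 0 < Nat.gcd n (Fintype.card Fq - 1) := Nat.gcd_pos_of_pos_left _ hn
  have hf : (X ^ Nat.gcd n (Fintype.card Fq - 1) - C 1 : Fq[X]) ≠ 0 :=
    X_pow_sub_C_ne_zero hpos 1
  have hnot := X_sub_one_notMem_geomFactors hn h
  set S := {P ∈ geomFactors Fq n | P.natDegree = 1} with hS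
  have hnS : (X - C 1 : Fq[X]) ∉ S := fun h' => hnot (mem_filter.1 h').1
  have hirr : ∀ P ∈ insert (X - C 1 : Fq[X]) S, Irreducible P ∧ P.Monic ∧ P.natDegree = 1 := by
    intro P hP
    rcases mem_insert.1 hP with rfl | hP
    · exact ⟨irreducible_X_sub_C 1, monic_X_sub_C 1, natDegree_X_sub_C 1⟩
    · have h1 := (mem_geomFactors hn).1 (mem_filter.1 hP).1
      exact ⟨h1.1, h1.2.1, (mem_filter.1 hP).2⟩
  have h := sum_natDegree_le_of_prod_dvd (T := insert (X - C 1 : Fq[X]) S)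
    (fun P hP => (hirr P hP).2.1) hf ?_
  · rw [natDegree_X_pow_sub_C, sum_congr rfl fun P hP => (hirr P hP).2.2, sum_const,
      card_insert_of_notMem hnS] at h
    simp at h
    omega
  · refine Finset.prod_dvd_of_coprime (fun P hP R hR hne => ?_) fun P hP => ?_
    · exact isCoprime_of_irreducible_of_monic (hirr P hP).1 (hirr P hP).2.1 (hirr R hR).1
        (hirr R hR).2.1 hne
    · rcases mem_insert.1 hP with rfl | hP
      · rw [dvd_iff_isRoot]; simp
      · have := dvd_X_pow_gcd_sub_one hn (mem_filter.1 hP).1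
        rwa [(mem_filter.1 hP).2, pow_one] at this

section Counts

variable {n D E : ℕ} {a : ℕ → ℕ}

theorem card_geomFactors_le (hn : 0 < n)
    (ha : ∀ d ∈ Icc 1 D, #{P ∈ geomFactors Fq n | P.natDegree = d} ≤ a d) :
    #{P ∈ geomFactors Fq n | P.natDegree ≤ D} ≤ ∑ d ∈ Icc 1 D, a d := by
  rw [card_eq_sum_card_fiberwise (f := natDegree) (t := Icc 1 D)]
  · refine sum_le_sum fun d hd => (card_le_card fun P hP => ?_).trans (ha d hd)
    simp only [mem_filter] at hP ⊢
    exact ⟨hP.1.1, hP.2⟩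
  · intro P hP
    have hP' := mem_filter.1 hP
    exact mem_Icc.2 ⟨natDegree_pos_of_mem_geomFactors hn hP'.1, hP'.2⟩

theorem prod_geomFactors_ge (hn : 0 < n) {q : ℝ} (hq : 1 ≤ q)
    (ha : ∀ d ∈ Icc 1 D, #{P ∈ geomFactors Fq n | P.natDegree = d} ≤ a d) :
    ∏ d ∈ Icc 1 D, (1 - 1 / q ^ d) ^ a d ≤
      ∏ P ∈ geomFactors Fq n with P.natDegree ≤ D, (1 - 1 / q ^ P.natDegree) := by
  have h0 : ∀ d : ℕ, 0 ≤ 1 - 1 / q ^ d ∧ 1 - 1 / q ^ d ≤ 1 := fun d =>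
    ⟨sub_nonneg.2 ((div_le_one (by positivity)).2 (one_le_pow₀ hq)), by
      have : 0 ≤ 1 / q ^ d := by positivity
      linarith⟩
  rw [← prod_fiberwise_of_maps_to (g := natDegree) (t := Icc 1 D)]
  · refine prod_le_prod (fun d _ => pow_nonneg (h0 d).1 _) fun d hd => ?_
    rw [prod_congr rfl fun P hP => by rw [(mem_filter.1 hP).2], prod_const]
    refine pow_le_pow_of_le_one (h0 d).1 (h0 d).2 ((card_le_card fun P hP => ?_).trans (ha d hd))
    simp only [mem_filter] at hP ⊢
    exact ⟨hP.1.1, hP.2⟩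
  · intro P hP
    have hP' := mem_filter.1 hP
    exact mem_Icc.2 ⟨natDegree_pos_of_mem_geomFactors hn hP'.1, hP'.2⟩

theorem card_geomFactors_lt_natDegree (hn : 0 < n) (E : ℕ) :
    #{P ∈ geomFactors Fq n | E < P.natDegree} ≤ (n - 1) / (E + 1) := by
  rw [Nat.le_div_iff_mul_le (by omega)]
  have h := sum_natDegree_le_of_prod_dvd (T := {P ∈ geomFactors Fq n | E < P.natDegree})
    (fun P hP => ((mem_geomFactors hn).1 (mem_filter.1 hP).1).2.1) (geomPoly_monic hn).ne_zero
    (prod_dvd_geomPoly hn (filter_subset _ _))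
  rw [natDegree_geomPoly hn] at h
  refine le_trans ?_ h
  rw [← smul_eq_mul, ← sum_const]
  exact sum_le_sum fun P hP => (mem_filter.1 hP).2

theorem sum_geomFactors_le (hn : 0 < n) {f : ℕ → ℝ} (hf : Antitone f)
    (hf0 : ∀ d, 0 ≤ f d)
    (ha : ∀ d ∈ Ioc D E, #{P ∈ geomFactors Fq n | P.natDegree = d} ≤ a d) :
    ∑ P ∈ geomFactors Fq n with D < P.natDegree, f P.natDegree ≤
      ∑ d ∈ Ioc D E, a d * f d + ((n - 1) / (E + 1) : ℕ) * f (E + 1) := by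
  rw [← sum_filter_add_sum_filter_not _ (fun P : Fq[X] => P.natDegree ≤ E)]
  refine add_le_add ?_ ?_
  · rw [← sum_fiberwise_of_maps_to (g := natDegree) (t := Ioc D E)]
    · refine sum_le_sum fun d hd => ?_
      rw [sum_congr rfl fun P hP => by rw [(mem_filter.1 hP).2], sum_const, nsmul_eq_mul]
      refine mul_le_mul_of_nonneg_right ?_ (hf0 d)
      refine Nat.cast_le.2 ((card_le_card fun P hP => ?_).trans (ha d hd))
      simp only [mem_filter] at hP ⊢
      exact ⟨hP.1.1.1, hP.2⟩
    · intro P hP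
      simp only [mem_filter] at hP
      exact mem_Ioc.2 ⟨hP.1.2, hP.2⟩
  · refine (sum_le_card_nsmul _ _ (f (E + 1)) fun P hP => ?_).trans ?_
    · simp only [mem_filter, not_le] at hP
      exact hf hP.2
    · rw [nsmul_eq_mul]
      refine mul_le_mul_of_nonneg_right ?_ (hf0 _)
      refine Nat.cast_le.2 <| (card_le_card fun P hP => ?_).trans
        (card_geomFactors_lt_natDegree hn E)
      simp only [mem_filter, not_le] at hP ⊢
      exact ⟨hP.1.1, hP.2⟩

theorem card_geomFactors_gt_le (hn : 0 < n)
    (ha : ∀ d ∈ Ioc D E, #{P ∈ geomFactors Fq n | P.natDegree = d} ≤ a d) :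
    #{P ∈ geomFactors Fq n | D < P.natDegree} ≤ ∑ d ∈ Ioc D E, a d + (n - 1) / (E + 1) := by
  have h := sum_geomFactors_le hn (f := fun _ => 1) antitone_const (fun _ => zero_le_one) ha
  simp only [sum_const, nsmul_eq_mul, mul_one] at h
  exact_mod_cast h

theorem sum_inv_geomFactors_le (hn : 0 < n) {q : ℝ} (hq : 1 ≤ q)
    (ha : ∀ d ∈ Ioc D E, #{P ∈ geomFactors Fq n | P.natDegree = d} ≤ a d) :
    ∑ P ∈ geomFactors Fq n with D < P.natDegree, 1 / q ^ P.natDegree ≤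
      ∑ d ∈ Ioc D E, a d * (1 / q ^ d) + ((n - 1) / (E + 1) : ℕ) * (1 / q ^ (E + 1)) :=
  sum_geomFactors_le hn (f := fun d => 1 / q ^ d)
    (fun i j hij => one_div_le_one_div_of_le (by positivity) (pow_le_pow_right₀ hq hij))
    (fun d => by positivity) ha

end Counts

end FactorCount

section PrimeBounds

open Finset

theorem mul_card_primeFactors_gt_le {N e M : ℕ} (hN : N ≠ 0) (he : 2 ^ e ≤ M + 1) :
    e * #{p ∈ N.primeFactors | M < p} ≤ Nat.log 2 N := by
  refine Nat.le_log_of_pow_le (by norm_num) ?_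
  calc 2 ^ (e * #{p ∈ N.primeFactors | M < p})
      = ∏ _p ∈ N.primeFactors with M < _p, 2 ^ e := by rw [prod_const, pow_mul]
    _ ≤ ∏ p ∈ N.primeFactors with M < p, p :=
        prod_le_prod' fun p hp => he.trans (mem_filter.1 hp).2
    _ ≤ ∏ p ∈ N.primeFactors, p :=
        prod_le_prod_of_subset_of_one_le' (filter_subset _ _) fun p hp _ =>
          (Nat.prime_of_mem_primeFactors hp).one_le
    _ ≤ N := Nat.le_of_dvd (Nat.pos_of_ne_zero hN) (Nat.prod_primeFactors_dvd N)

theorem sum_inv_primeFactors_gt_le {N k M : ℕ} (hk : #{p ∈ N.primeFactors | M < p} ≤ k) :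
    ∑ p ∈ N.primeFactors with M < p, (1 / p : ℝ) ≤ k * (1 / (M + 1 : ℕ)) := by
  refine (sum_le_card_nsmul _ _ (1 / (M + 1 : ℕ) : ℝ) fun p hp => ?_).trans ?_
  · exact one_div_le_one_div_of_le (by positivity) (Nat.cast_le.2 (mem_filter.1 hp).2)
  · rw [nsmul_eq_mul]
    gcongr

theorem prod_primeFactors_le_four_pow (N M : ℕ) : ∏ p ∈ N.primeFactors with p ≤ M, p ≤ 4 ^ M := by
  refine le_trans ?_ (primorial_le_four_pow M)
  refine prod_le_prod_of_subset_of_one_le' (fun p hp => ?_) fun p hp _ => ?_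
  · have hp' := mem_filter.1 hp
    exact mem_filter.2 ⟨mem_range.2 (by omega), Nat.prime_of_mem_primeFactors hp'.1⟩
  · exact (mem_filter.1 hp).2.one_le

theorem prod_Icc_one_sub_inv {M : ℕ} (hM : 1 ≤ M) :
    ∏ j ∈ Icc 2 M, (1 - 1 / j : ℝ) = 1 / M := by
  induction M, hM using Nat.le_induction with
  | base => simp
  | succ M hM ih =>
    rw [prod_Icc_succ_top (by omega), ih]
    have : (M : ℝ) ≠ 0 := by positivity
    push_cast
    field_simp
    ring

theorem one_sub_inv_mem {j : ℕ} (hj : 1 ≤ j) : (0 : ℝ) ≤ 1 - 1 / j ∧ (1 - 1 / j : ℝ) ≤ 1 :=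
  ⟨sub_nonneg.2 ((div_le_one (by positivity)).2 (by exact_mod_cast hj)), by
    have : (0 : ℝ) ≤ 1 / j := by positivity
    linarith⟩

theorem inv_le_prod_primeFactors {M : ℕ} (hM : 1 ≤ M) (N : ℕ) :
    (1 / M : ℝ) ≤ ∏ p ∈ N.primeFactors with p ≤ M, (1 - 1 / p : ℝ) := by
  rw [← prod_Icc_one_sub_inv hM]
  refine prod_le_prod_of_subset_of_le_one (fun p hp => ?_)
    (fun j hj => (one_sub_inv_mem (by have := mem_Icc.1 hj; omega)).1)
    fun j hj _ => (one_sub_inv_mem (by have := mem_Icc.1 hj; omega)).2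
  have hp' := mem_filter.1 hp
  exact mem_Icc.2 ⟨(Nat.prime_of_mem_primeFactors hp'.1).two_le, hp'.2⟩

theorem log_two_le {q n : ℕ} (hq : q = 2 ∨ q = 3) : 5 * Nat.log 2 (q ^ n - 1) ≤
    if q = 2 then 5 * n else 8 * n := by
  have h : Nat.log 2 (q ^ n - 1) ≤ Nat.log 2 (q ^ n) := Nat.log_mono_right (Nat.sub_le _ _)
  have hp : 2 ^ Nat.log 2 (q ^ n) ≤ q ^ n := Nat.pow_log_le_self 2 (by
    rcases hq with rfl | rfl <;> positivity)
  rcases hq with rfl | rfl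
  · simp only [if_true]
    rw [Nat.pow_le_pow_iff_right (by norm_num)] at hp
    omega
  · simp only [show ¬ (3 = 2) by norm_num, if_false]
    have h2 : 2 ^ (5 * Nat.log 2 (3 ^ n)) ≤ 2 ^ (8 * n) := by
      calc 2 ^ (5 * Nat.log 2 (3 ^ n)) = (2 ^ Nat.log 2 (3 ^ n)) ^ 5 := by rw [← pow_mul, mul_comm]
        _ ≤ (3 ^ n) ^ 5 := by gcongr
        _ = (3 ^ 5) ^ n := by rw [← pow_mul, ← pow_mul, mul_comm]
        _ ≤ (2 ^ 8) ^ n := Nat.pow_le_pow_left (by norm_num) n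
        _ = 2 ^ (8 * n) := by rw [← pow_mul]
    rw [Nat.pow_le_pow_iff_right (by norm_num)] at h2
    omega

end PrimeBounds

section NumericCriterion

open Finset

/-- An inequality between natural numbers that implies the sieve inequality. -/
def NumCheck (q lo D E : ℕ) (a : ℕ → ℕ) (m u v k t r : ℕ) : Prop :=
  t + 2 * (∑ d ∈ Ioc D E, a d * (4294967296 / q ^ d + 1) +
    r * (4294967296 / q ^ (E + 1) + 1)) < 4294967296 ∧
  24 * q ^ 8 * 256 ^ (∑ d ∈ Icc 1 D, a d) * (1 + k + 2 * (∑ d ∈ Ioc D E, a d + r)) ^ 4 * m *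
    v ^ 2 * q ^ (8 * ∑ d ∈ Icc 1 D, d * a d) * 4294967296 ^ 4 <
  7 * q ^ lo * u ^ 2 * (∏ d ∈ Icc 1 D, (q ^ d - 1) ^ a d) ^ 8 *
    (4294967296 - (t + 2 * (∑ d ∈ Ioc D E, a d * (4294967296 / q ^ d + 1) +
      r * (4294967296 / q ^ (E + 1) + 1)))) ^ 4

theorem one_div_le_div_add_one (b : ℕ) : (1 / b : ℝ) ≤ (4294967296 / b + 1 : ℕ) / 4294967296 := by
  rcases Nat.eq_zero_or_pos b with rfl | hb
  · simp
  · have h := Nat.lt_mul_div_succ 4294967296 hb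
    rw [div_le_div_iff₀ (by positivity) (by norm_num)]
    have : (4294967296 : ℝ) < b * (4294967296 / b + 1 : ℕ) := by exact_mod_cast h
    linarith

variable {Fq F : Type*} [Field Fq] [Field F] [Fintype Fq] [Algebra Fq F] [Fintype F]

theorem exists_primitive_pair_of_numCheck {q n : ℕ} (hcard : Fintype.card Fq = q) (hn : 14 ≤ n)
    (hdim : Module.finrank Fq F = n) {C : Finset ℕ} (hC : C ⊆ (q ^ n - 1).primeFactors)
    {lo D E m u v k t r : ℕ} {a : ℕ → ℕ} (hlo : lo ≤ n) (hDE : D ≤ E)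
    (ha : ∀ d ∈ Icc 1 E, #{P ∈ geomFactors Fq n | P.natDegree = d} ≤ a d)
    (hm : ∏ p ∈ C, p ≤ m) (hu : 0 < u) (hv : 0 < v) (huv : (u / v : ℝ) ≤ ∏ p ∈ C, (1 - 1 / p : ℝ))
    (hk : #((q ^ n - 1).primeFactors \ C) ≤ k)
    (ht : ∑ p ∈ (q ^ n - 1).primeFactors \ C, (1 / p : ℝ) ≤ t / 4294967296)
    (hr : (n - 1) / (E + 1) ≤ r) (h : NumCheck q lo D E a m u v k t r) :
    ∃ α : F, α ≠ 0 ∧ orderOf α = q ^ n - 1 ∧ IsKNormal Fq q n 1 α ∧ IsKNormal Fq q n 1 α⁻¹ := by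
  have hn0 : 0 < n := by omega
  have hq2 : 2 ≤ q := by rw [← hcard]; exact Fintype.one_lt_card
  have hq1 : (1 : ℝ) < q := by exact_mod_cast hq2
  have haD : ∀ d ∈ Icc 1 D, #{P ∈ geomFactors Fq n | P.natDegree = d} ≤ a d := fun d hd =>
    ha d (Icc_subset_Icc_right hDE hd)
  have haE : ∀ d ∈ Ioc D E, #{P ∈ geomFactors Fq n | P.natDegree = d} ≤ a d := fun d hd =>
    ha d (by rw [mem_Ioc] at hd; exact mem_Icc.2 ⟨by omega, hd.2⟩)
  obtain ⟨h1, h2⟩ := h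
  set s := ∑ d ∈ Ioc D E, a d * (4294967296 / q ^ d + 1) +
    r * (4294967296 / q ^ (E + 1) + 1) with hs
  set R := ∑ d ∈ Ioc D E, a d + r with hR
  have hσ : ∑ P ∈ geomFactors Fq n with D < P.natDegree, (1 / (q : ℝ) ^ P.natDegree) ≤
      s / 4294967296 := by
    refine (sum_inv_geomFactors_le hn0 hq1.le haE).trans ?_
    rw [hs]
    push_cast
    rw [add_div, sum_div]
    refine add_le_add (sum_le_sum fun d _ => ?_) ?_
    · have := one_div_le_div_add_one (q ^ d)
      push_cast at this
      rw [mul_div_assoc]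
      gcongr
    · have := one_div_le_div_add_one (q ^ (E + 1))
      push_cast at this
      rw [mul_div_assoc]
      gcongr
  have hqd : ∀ d ∈ Icc 1 D, (0 : ℝ) < 1 - 1 / (q : ℝ) ^ d := fun d hd => by
    rw [sub_pos, div_lt_one (by positivity)]
    exact one_lt_pow₀ hq1 (by have := mem_Icc.1 hd; omega)
  have hδ : ∏ d ∈ Icc 1 D, (1 - 1 / (q : ℝ) ^ d) ^ a d =
      (∏ d ∈ Icc 1 D, (q ^ d - 1) ^ a d : ℕ) / (q : ℝ) ^ (∑ d ∈ Icc 1 D, d * a d) := by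
    rw [← prod_pow_eq_pow_sum, Nat.cast_prod, ← prod_div_distrib]
    refine prod_congr rfl fun d _ => ?_
    have : (1 : ℕ) ≤ q ^ d := Nat.one_le_pow _ _ (by omega)
    rw [Nat.cast_pow, Nat.cast_sub this, pow_mul, ← div_pow]
    push_cast
    congr 1
    field_simp
  refine exists_primitive_pair_of_bounds hcard hn hdim hC D m (∑ d ∈ Icc 1 D, a d) k R hm
    (δC := u / v) (by positivity) huv hk ht (card_geomFactors_le hn0 haD)
    (prod_pos fun d hd => pow_pos (hqd d hd) _) (prod_geomFactors_ge hn0 hq1.le haD)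
    ((card_geomFactors_gt_le hn0 haE).trans (by omega)) hσ ?_ ?_
  · have : (t : ℝ) + 2 * s < 4294967296 := by exact_mod_cast h1
    linarith
  · rw [hδ]
    generalize ∏ d ∈ Icc 1 D, (q ^ d - 1) ^ a d = Z at *
    generalize ∑ d ∈ Icc 1 D, d * a d = S at *
    generalize ∑ d ∈ Icc 1 D, a d = c at *
    have h3 : (24 * q ^ 8 * 256 ^ c * (1 + k + 2 * R) ^ 4 * m * v ^ 2 * q ^ (8 * S) *
        4294967296 ^ 4 : ℝ) < 7 * q ^ lo * u ^ 2 * Z ^ 8 * (4294967296 - (t + 2 * s : ℕ)) ^ 4 := by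
      have := (Nat.cast_lt (α := ℝ)).2 h2
      rw [Nat.cast_mul _ ((4294967296 - (t + 2 * s)) ^ 4), Nat.cast_pow (4294967296 - (t + 2 * s)),
        Nat.cast_sub h1.le] at this
      exact_mod_cast this
    have e1 : (1 - (t : ℝ) / 4294967296 - 2 * (s / 4294967296)) =
        (4294967296 - (t + 2 * s : ℕ)) / 4294967296 := by
      push_cast; ring
    have hv' : (0 : ℝ) < v := by exact_mod_cast hv
    have hq0 : (0 : ℝ) < q := by linarith
    have e2 : 7 * (q : ℝ) ^ n * (u / v : ℝ) ^ 2 * (Z / (q : ℝ) ^ S) ^ 8 *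
        ((4294967296 - (t + 2 * s : ℕ)) / 4294967296) ^ 4 =
        7 * (q : ℝ) ^ n * u ^ 2 * Z ^ 8 * (4294967296 - (t + 2 * s : ℕ)) ^ 4 /
          (v ^ 2 * q ^ (8 * S) * 4294967296 ^ 4) := by
      rw [div_pow, div_pow, div_pow, ← pow_mul, mul_comm S 8]
      field_simp
    rw [e1, e2, lt_div_iff₀ (by positivity)]
    calc _ = (24 * q ^ 8 * 256 ^ c * (1 + k + 2 * R) ^ 4 * m * v ^ 2 * q ^ (8 * S) *
        4294967296 ^ 4 : ℝ) := by ring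
      _ < _ := h3
      _ ≤ _ := by
        gcongr
        exact hq1.le

end NumericCriterion

section Ranges

open Finset

/-- An upper bound for the number of irreducible factors of degree `d` of `(X ^ n - 1) / (X - 1)`
over a field with `q` elements. -/
def gcdCount (q n d : ℕ) : ℕ :=
  bif Nat.beq d 1 then
    bif Nat.beq (n % q) 0 then Nat.gcd n (q - 1) else Nat.gcd n (q - 1) - 1
  else Nat.gcd n (q ^ d - 1) / d

/-- An upper bound, independent of `n`, for the number of irreducible factors of degree `d` of
`(X ^ n - 1) / (X - 1)` over a field with `q` elements. -/
def degCount (q d : ℕ) : ℕ := (q ^ d - 1) / d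

/-- An upper bound for `log 2 (q ^ n)`. -/
def bitBound (q n : ℕ) : ℕ := if q = 2 then n else 8 * n / 5

/-- The sum of `f d` over `s ≤ d < s + k`. -/
def natSum (f : ℕ → ℕ) (s k : ℕ) : ℕ :=
  Nat.rec (motive := fun _ => ℕ) 0 (fun i acc => Nat.add acc (f (Nat.add s i))) k

/-- The product of `f d` over `s ≤ d < s + k`. -/
def natProd (f : ℕ → ℕ) (s k : ℕ) : ℕ :=
  Nat.rec (motive := fun _ => ℕ) 1 (fun i acc => Nat.mul acc (f (Nat.add s i))) k

/-- Whether `f d` holds for all `s ≤ d < s + k`. -/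
def natAll (f : ℕ → Bool) (s k : ℕ) : Bool :=
  Nat.rec (motive := fun _ => Bool) true (fun i acc => acc && f (Nat.add s i)) k

theorem natSum_eq (f : ℕ → ℕ) (s k : ℕ) : natSum f s k = ∑ d ∈ Ico s (s + k), f d := by
  induction k with
  | zero => simp [natSum]
  | succ k ih => rw [← add_assoc, sum_Ico_succ_top (by omega), ← ih]; rfl

theorem natProd_eq (f : ℕ → ℕ) (s k : ℕ) : natProd f s k = ∏ d ∈ Ico s (s + k), f d := by
  induction k with
  | zero => simp [natProd]
  | succ k ih => rw [← add_assoc, prod_Ico_succ_top (by omega), ← ih]; rfl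

theorem of_natAll {f : ℕ → Bool} {s k : ℕ} (h : natAll f s k = true) {n : ℕ} (hs : s ≤ n)
    (hn : n < s + k) : f n = true := by
  induction k with
  | zero => omega
  | succ k ih =>
    have h' : (natAll f s k && f (s + k)) = true := h
    rw [Bool.and_eq_true] at h'
    rcases Nat.lt_or_ge n (s + k) with hlt | hge
    · exact ih h'.1 hlt
    · rw [show n = s + k by omega]; exact h'.2

/-- A version of `NumCheck` that the kernel evaluates efficiently. -/
def numCheck (q lo D E : ℕ) (a : ℕ → ℕ) (m u v k t r : ℕ) : Bool :=
  Nat.ble (t + 2 * (natSum (fun d => a d * (4294967296 / q ^ d + 1)) (D + 1) (E - D) +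
    r * (4294967296 / q ^ (E + 1) + 1)) + 1) 4294967296 &&
  Nat.ble (24 * q ^ 8 * 256 ^ (natSum a 1 D) *
    (1 + k + 2 * (natSum a (D + 1) (E - D) + r)) ^ 4 * m *
    v ^ 2 * q ^ (8 * natSum (fun d => d * a d) 1 D) * 4294967296 ^ 4 + 1)
  (7 * q ^ lo * u ^ 2 * (natProd (fun d => (q ^ d - 1) ^ a d) 1 D) ^ 8 *
    (4294967296 - (t + 2 * (natSum (fun d => a d * (4294967296 / q ^ d + 1)) (D + 1) (E - D) +
      r * (4294967296 / q ^ (E + 1) + 1)))) ^ 4)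

theorem NumCheck.of_numCheck {q lo D E : ℕ} {a : ℕ → ℕ} {m u v k t r : ℕ} (hDE : D ≤ E)
    (h : numCheck q lo D E a m u v k t r = true) : NumCheck q lo D E a m u v k t r := by
  rw [numCheck, Bool.and_eq_true, Nat.ble_eq, Nat.ble_eq] at h
  have e1 : D + 1 + (E - D) = E + 1 := by omega
  have e2 : Ico (D + 1) (E + 1) = Ioc D E := by ext; simp only [mem_Ico, mem_Ioc]; omega
  have e3 : Ico 1 (1 + D) = Icc 1 D := by ext; simp only [mem_Ico, mem_Icc]; omega
  simp only [natSum_eq, natProd_eq, e1, e2, e3] at h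
  exact h

/-- The criterion obtained by putting all primes up to `M` in the core of the sieve. -/
def genericCheck (q lo hi M e D E : ℕ) (a : ℕ → ℕ) : Bool :=
  Nat.ble (2 ^ e) (M + 1) && Nat.ble 1 e && Nat.ble 1 M && Nat.ble D E &&
    numCheck q lo D E a (4 ^ M) 1 M (bitBound q hi / e)
    (bitBound q hi / e * (4294967296 / (M + 1) + 1)) ((hi - 1) / (E + 1))

def smallPrimes : List ℕ :=
  [2, 3, 5, 7, 11, 13, 17, 19, 23, 29, 31, 37, 41, 43, 47, 53, 59, 61, 67, 71, 73, 79, 83, 89, 97,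
    101, 103, 107, 109, 113, 127, 131, 137, 139, 149, 151, 157, 163, 167, 173, 179, 181, 191, 193,
    197, 199, 211, 223, 227, 229, 233, 239, 241, 251]

theorem mem_smallPrimes {p : ℕ} : p ∈ smallPrimes ↔ p.Prime ∧ p ≤ 256 := by
  constructor
  · intro h
    have : ∀ p ∈ smallPrimes, p.Prime ∧ p ≤ 256 := by
      unfold smallPrimes; norm_num
    exact this p h
  · rintro ⟨h1, h2⟩
    have : ∀ p < 257, (∀ d ∈ [2, 3, 5, 7, 11, 13], d ∣ p → d = p) → 2 ≤ p → p ∈ smallPrimes := by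
      decide +kernel
    refine this p (by omega) (fun d hd hdp => ?_) h1.two_le
    refine ((Nat.dvd_prime h1).1 hdp).resolve_left ?_
    rintro rfl
    simp at hd

/-- The prime divisors `p` of `N` with `p ≤ M`, provided that `M ≤ 256`. -/
def corePrimes (N M : ℕ) : List ℕ :=
  smallPrimes.filter fun p => Nat.beq (N % p) 0 && Nat.ble p M

/-- The prime divisors `p` of `N` with `M < p ≤ 256`. -/
def restPrimes (N M : ℕ) : List ℕ :=
  smallPrimes.filter fun p => Nat.beq (N % p) 0 && Nat.ble (M + 1) p

/-- The criterion obtained by determining all prime factors up to `256` of `q ^ n - 1`. -/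
def factorCheck (q n M D E : ℕ) : Bool :=
  Nat.ble D E && Nat.ble M 256 &&
  numCheck q n D E (gcdCount q n) (corePrimes (q ^ n - 1) M).prod
    ((corePrimes (q ^ n - 1) M).map fun p => p - 1).prod (corePrimes (q ^ n - 1) M).prod
    ((restPrimes (q ^ n - 1) M).length + bitBound q n / 8)
    (((restPrimes (q ^ n - 1) M).map fun p => 4294967296 / p + 1).sum +
      bitBound q n / 8 * (4294967296 / 257 + 1)) ((n - 1) / (E + 1))

theorem mem_corePrimes {N M p : ℕ} (hN : N ≠ 0) :
    p ∈ corePrimes N M ↔ p ∈ N.primeFactors ∧ p ≤ M ∧ p ≤ 256 := by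
  simp only [corePrimes, List.mem_filter, mem_smallPrimes, Bool.and_eq_true, Nat.beq_eq,
    Nat.ble_eq, Nat.mem_primeFactors, Nat.dvd_iff_mod_eq_zero]
  tauto

theorem mem_restPrimes {N M p : ℕ} (hN : N ≠ 0) :
    p ∈ restPrimes N M ↔ p ∈ N.primeFactors ∧ M < p ∧ p ≤ 256 := by
  simp only [restPrimes, List.mem_filter, mem_smallPrimes, Bool.and_eq_true, Nat.beq_eq,
    Nat.ble_eq, Nat.mem_primeFactors, Nat.dvd_iff_mod_eq_zero, Nat.succ_le_iff]
  tauto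

theorem nodup_smallPrimes : smallPrimes.Nodup := by decide +kernel

theorem log_two_le_bitBound {q n : ℕ} (hq : q = 2 ∨ q = 3) :
    Nat.log 2 (q ^ n - 1) ≤ bitBound q n := by
  have := log_two_le (n := n) hq
  rw [bitBound]
  split_ifs at this ⊢ <;> omega

variable {Fq F : Type*} [Field Fq] [Field F] [Fintype Fq] [Algebra Fq F] [Fintype F]

theorem card_geomFactors_le_gcdCount {q n : ℕ} (hcard : Fintype.card Fq = q) (hn : 0 < n) {d : ℕ}
    (hd : 1 ≤ d) (hq : q = 2 ∨ q = 3) :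
    #{P ∈ geomFactors Fq n | P.natDegree = d} ≤ gcdCount q n d := by
  have h := card_geomFactors_mul_le (Fq := Fq) hn d
  rw [hcard] at h
  by_cases h1 : d = 1
  · subst h1
    rw [mul_one, pow_one] at h
    rw [gcdCount, show Nat.beq 1 1 = true from rfl, cond_true]
    cases h0 : Nat.beq (n % q) 0
    swap
    · exact h
    · have hne : (n : Fq) ≠ 0 := by
        intro h2
        have hp : q.Prime := by rcases hq with rfl | rfl <;> norm_num
        have : CharP Fq q := by
          obtain ⟨p, hp'⟩ := CharP.exists Fq
          have := hp'
          obtain ⟨k, hpp, hk⟩ := FiniteField.card Fq p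
          rw [hcard] at hk
          have : p = q := ((Nat.prime_dvd_prime_iff_eq hpp hp).1 (hk ▸ dvd_pow_self p k.ne_zero))
          rwa [this] at hp'
        rw [CharP.cast_eq_zero_iff Fq q] at h2
        simp [Nat.mod_eq_zero_of_dvd h2] at h0
      have := card_geomFactors_one_lt (Fq := Fq) hn hne
      rw [hcard] at this
      rw [cond_false]
      omega
  · rw [gcdCount, show Nat.beq d 1 = false from
      Bool.eq_false_iff.2 fun h => h1 (Nat.eq_of_beq_eq_true h), cond_false]
    exact (Nat.le_div_iff_mul_le (by omega)).2 h

theorem card_geomFactors_le_degCount {q n : ℕ} (hcard : Fintype.card Fq = q) (hn : 0 < n) {d : ℕ}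
    (hd : 1 ≤ d) : #{P ∈ geomFactors Fq n | P.natDegree = d} ≤ degCount q d := by
  have h := card_geomFactors_mul_le (Fq := Fq) hn d
  rw [hcard] at h
  have hq : 1 < q := by rw [← hcard]; exact Fintype.one_lt_card
  have : 1 < q ^ d := Nat.one_lt_pow (by omega) hq
  exact (Nat.le_div_iff_mul_le (by omega)).2 (h.trans (Nat.gcd_le_right _ (by omega)))

theorem exists_primitive_pair_of_genericCheck {q n : ℕ} (hcard : Fintype.card Fq = q)
    (hq : q = 2 ∨ q = 3) (hn : 14 ≤ n) (hdim : Module.finrank Fq F = n)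
    {lo hi M e D E : ℕ} {a : ℕ → ℕ} (hlo : lo ≤ n) (hhi : n ≤ hi)
    (ha : ∀ d ∈ Icc 1 E, #{P ∈ geomFactors Fq n | P.natDegree = d} ≤ a d)
    (h : genericCheck q lo hi M e D E a = true) :
    ∃ α : F, α ≠ 0 ∧ orderOf α = q ^ n - 1 ∧ IsKNormal Fq q n 1 α ∧ IsKNormal Fq q n 1 α⁻¹ := by
  simp only [genericCheck, Bool.and_eq_true, Nat.ble_eq] at h
  obtain ⟨⟨⟨⟨he, he1⟩, hM⟩, hDE⟩, h⟩ := h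
  have hN : q ^ n - 1 ≠ 0 := by
    have : 1 < q ^ n := Nat.one_lt_pow (by omega) (by omega)
    omega
  have hsd : (q ^ n - 1).primeFactors \ {p ∈ (q ^ n - 1).primeFactors | p ≤ M} =
      {p ∈ (q ^ n - 1).primeFactors | M < p} := by
    rw [← filter_not]; simp only [not_le]
  have hk : #{p ∈ (q ^ n - 1).primeFactors | M < p} ≤ bitBound q hi / e := by
    rw [Nat.le_div_iff_mul_le (by omega), mul_comm]
    refine (mul_card_primeFactors_gt_le hN he).trans ((log_two_le_bitBound hq).trans ?_)
    simp only [bitBound]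
    split_ifs <;> omega
  refine exists_primitive_pair_of_numCheck hcard hn hdim (filter_subset (· ≤ M) _) hlo hDE ha
    (prod_primeFactors_le_four_pow _ M) one_pos (by omega)
    (by simpa using inv_le_prod_primeFactors hM (q ^ n - 1)) (hsd ▸ hk) ?_
    (Nat.div_le_div_right (by omega)) (NumCheck.of_numCheck hDE h)
  rw [hsd]
  refine (sum_inv_primeFactors_gt_le hk).trans ?_
  rw [Nat.cast_mul, mul_div_assoc]
  exact mul_le_mul_of_nonneg_left (one_div_le_div_add_one (M + 1)) (Nat.cast_nonneg _)

theorem exists_primitive_pair_of_factorCheck {q n : ℕ} (hcard : Fintype.card Fq = q)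
    (hq : q = 2 ∨ q = 3) (hn : 14 ≤ n) (hdim : Module.finrank Fq F = n)
    {M D E : ℕ} (h : factorCheck q n M D E = true) :
    ∃ α : F, α ≠ 0 ∧ orderOf α = q ^ n - 1 ∧ IsKNormal Fq q n 1 α ∧ IsKNormal Fq q n 1 α⁻¹ := by
  simp only [factorCheck, Bool.and_eq_true, Nat.ble_eq] at h
  obtain ⟨⟨hDE, hM⟩, h⟩ := h
  have hN : q ^ n - 1 ≠ 0 := by
    have : 1 < q ^ n := Nat.one_lt_pow (by omega) (by omega)
    omega
  set N := q ^ n - 1 with hNdef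
  have hcn : (corePrimes N M).Nodup := nodup_smallPrimes.filter _
  have hrn : (restPrimes N M).Nodup := nodup_smallPrimes.filter _
  have hcp : ∀ p ∈ corePrimes N M, 2 ≤ p := fun p hp =>
    (Nat.prime_of_mem_primeFactors ((mem_corePrimes hN).1 hp).1).two_le
  have hsd : N.primeFactors \ (corePrimes N M).toFinset =
      (restPrimes N M).toFinset ∪ {p ∈ N.primeFactors | 256 < p} := by
    ext p
    simp only [mem_sdiff, mem_union, List.mem_toFinset, mem_corePrimes hN, mem_restPrimes hN,
      mem_filter]
    constructor
    · rintro ⟨h1, h2⟩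
      by_cases hp : p ≤ 256
      · exact Or.inl ⟨h1, not_le.1 fun h3 => h2 ⟨h1, h3, hp⟩, hp⟩
      · exact Or.inr ⟨h1, by omega⟩
    · rintro (⟨h1, h2, _⟩ | ⟨h1, h2⟩)
      · exact ⟨h1, by omega⟩
      · exact ⟨h1, by omega⟩
  have hk : #{p ∈ N.primeFactors | 256 < p} ≤ bitBound q n / 8 := by
    rw [Nat.le_div_iff_mul_le (by omega), mul_comm]
    exact (mul_card_primeFactors_gt_le hN (by norm_num)).trans (log_two_le_bitBound hq)
  refine exists_primitive_pair_of_numCheck hcard hn hdim (C := (corePrimes N M).toFinset)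
    (fun p hp => ((mem_corePrimes hN).1 (List.mem_toFinset.1 hp)).1) le_rfl hDE
    (fun d hd => card_geomFactors_le_gcdCount hcard (by omega) (mem_Icc.1 hd).1 hq)
    (m := (corePrimes N M).prod) ?_ ?_ ?_ ?_ ?_ ?_ le_rfl (NumCheck.of_numCheck hDE h)
  · rw [List.prod_toFinset _ hcn, List.map_id']
  · refine List.prod_pos fun x hx => ?_
    obtain ⟨p, hp, rfl⟩ := List.mem_map.1 hx
    have := hcp p hp
    omega
  · exact List.prod_pos fun p hp => by have := hcp p hp; omega
  · rw [← List.map_id' (corePrimes N M), ← List.prod_toFinset _ hcn, List.map_id',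
      ← List.prod_toFinset _ hcn, Nat.cast_prod, Nat.cast_prod, ← prod_div_distrib]
    refine le_of_eq (prod_congr rfl fun p hp => ?_)
    have h2 := hcp p (List.mem_toFinset.1 hp)
    have : (p : ℝ) ≠ 0 := by positivity
    rw [Nat.cast_sub (by omega)]
    field_simp
    simp
  · rw [hsd]
    refine (card_union_le _ _).trans (add_le_add ?_ hk)
    exact List.toFinset_card_le _
  · rw [hsd]
    rw [sum_union, Nat.cast_add, add_div]
    · refine add_le_add ?_ ((sum_inv_primeFactors_gt_le hk).trans ?_)
      · rw [← List.sum_toFinset _ hrn, Nat.cast_sum, sum_div]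
        exact sum_le_sum fun p _ => one_div_le_div_add_one p
      · rw [Nat.cast_mul, mul_div_assoc]
        exact mul_le_mul_of_nonneg_left (one_div_le_div_add_one (256 + 1)) (Nat.cast_nonneg _)
    · refine disjoint_left.2 fun p h1 h2 => ?_
      have h3 := ((mem_restPrimes hN).1 (List.mem_toFinset.1 h1)).2.2
      have h4 := (mem_filter.1 h2).2
      omega

end Ranges

section MediumRanges

open Finset

/-- The values of `n < 512` that the sieve does not cover. -/
def exceptionalDegrees (q : ℕ) : List ℕ :=
  bif Nat.beq q 2 then
    [14, 15, 16, 17, 18, 19, 20, 21, 22, 24, 26, 27, 28, 30, 32, 33, 34, 35, 36, 38, 40, 42, 44, 45,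
      48, 54, 56, 60]
  else [14, 15, 16, 17, 18, 20, 21, 22, 24, 26, 28, 30, 32, 36, 40, 48, 56]

/-- Membership in a list of natural numbers, in a form the kernel evaluates efficiently. -/
def natElem (n : ℕ) (l : List ℕ) : Bool := l.any (Nat.beq n)

theorem mem_of_natElem {n : ℕ} {l : List ℕ} (h : natElem n l = true) : n ∈ l := by
  obtain ⟨a, ha, h⟩ := List.any_eq_true.1 h
  rwa [Nat.eq_of_beq_eq_true h]

set_option maxRecDepth 100000 in
theorem factorCheck_two_lt_512 : natAll (fun n => natElem n (exceptionalDegrees 2) ||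
    factorCheck 2 n 5 4 8 || factorCheck 2 n 7 2 8 || factorCheck 2 n 5 6 8) 14 498 = true := by
  decide +kernel

set_option maxRecDepth 100000 in
theorem factorCheck_three_lt_512 : natAll (fun n => natElem n (exceptionalDegrees 3) ||
    factorCheck 3 n 17 3 8 || factorCheck 3 n 5 1 8 || factorCheck 3 n 5 2 8 ||
    factorCheck 3 n 2 0 8) 14 498 = true := by
  decide +kernel

set_option maxRecDepth 100000 in
theorem genericCheck_two_lt_4096 : natAll (fun n =>
    genericCheck 2 n n (n / 4) (Nat.log2 (n / 4 + 1)) 5 12 (gcdCount 2 n)) 512 3584 = true := by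
  decide +kernel

set_option maxRecDepth 100000 in
theorem genericCheck_three_lt_2048 : natAll (fun n =>
    genericCheck 3 n n (n / 3) (Nat.log2 (n / 3 + 1)) 6 12 (gcdCount 3 n) ||
    factorCheck 3 n 17 4 8) 512 1536 = true := by
  decide +kernel

/-- The intervals covered by `genericCheck` with `degCount`, together with the parameters. -/
def sieveIntervals (q : ℕ) : List (ℕ × ℕ × ℕ × ℕ) :=
  bif Nat.beq q 2 then
    [(4096, 5264, 5, 10), (5265, 6539, 4, 10), (6540, 9170, 6, 11), (9171, 13415, 5, 11),
      (13416, 21591, 6, 12), (21592, 31290, 8, 13), (31291, 60014, 6, 13), (60015, 118154, 6, 14),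
      (118155, 236079, 6, 15), (236080, 471698, 6, 16), (471699, 942476, 6, 17),
      (942477, 1702716, 5, 17)]
  else
    [(2048, 2256, 3, 6), (2257, 2745, 3, 6), (2746, 3887, 3, 6), (3888, 4404, 2, 6),
      (4405, 5471, 4, 7), (5472, 8838, 4, 7), (8839, 14621, 3, 7), (14622, 29215, 5, 8),
      (29216, 53867, 6, 9), (53868, 107630, 4, 9), (107631, 215051, 5, 10), (215052, 429683, 4, 10),
      (429684, 858528, 4, 11), (858529, 1715381, 3, 11)]

set_option maxRecDepth 100000 in
theorem genericCheck_two_ge_4096 : (sieveIntervals 2).all (fun x => genericCheck 2 x.1 x.2.1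
    (x.2.1 / x.2.2.1) (Nat.log2 (x.2.1 / x.2.2.1 + 1)) x.2.2.2 x.2.2.2 (degCount 2)) = true := by
  decide +kernel

set_option maxRecDepth 100000 in
theorem genericCheck_three_ge_2048 : (sieveIntervals 3).all (fun x => genericCheck 3 x.1 x.2.1
    (x.2.1 / x.2.2.1) (Nat.log2 (x.2.1 / x.2.2.1 + 1)) x.2.2.2 x.2.2.2 (degCount 3)) = true := by
  decide +kernel

variable {Fq F : Type*} [Field Fq] [Field F] [Fintype Fq] [Algebra Fq F] [Fintype F]

theorem exists_primitive_pair_of_lt_two_pow {q n : ℕ} (hcard : Fintype.card Fq = q)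
    (hq : q = 2 ∨ q = 3) (hn : 14 ≤ n) (hn' : n < 2 ^ 20) (hdim : Module.finrank Fq F = n)
    (hex : n ∉ exceptionalDegrees q) :
    ∃ α : F, α ≠ 0 ∧ orderOf α = q ^ n - 1 ∧ IsKNormal Fq q n 1 α ∧ IsKNormal Fq q n 1 α⁻¹ := by
  have hg : ∀ E, ∀ d ∈ Icc 1 E, #{P ∈ geomFactors Fq n | P.natDegree = d} ≤ gcdCount q n d :=
    fun E d hd => card_geomFactors_le_gcdCount hcard (by omega) (mem_Icc.1 hd).1 hq
  have hd : ∀ E, ∀ d ∈ Icc 1 E, #{P ∈ geomFactors Fq n | P.natDegree = d} ≤ degCount q d :=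
    fun E d hd => card_geomFactors_le_degCount hcard (by omega) (mem_Icc.1 hd).1
  have hgeneric : ∀ x ∈ sieveIntervals q, genericCheck q x.1 x.2.1 (x.2.1 / x.2.2.1)
      (Nat.log2 (x.2.1 / x.2.2.1 + 1)) x.2.2.2 x.2.2.2 (degCount q) = true := by
    rcases hq with rfl | rfl
    · exact List.all_eq_true.1 genericCheck_two_ge_4096
    · exact List.all_eq_true.1 genericCheck_three_ge_2048
  have hcover : (∃ x ∈ sieveIntervals q, x.1 ≤ n ∧ n ≤ x.2.1) →
      ∃ α : F, α ≠ 0 ∧ orderOf α = q ^ n - 1 ∧ IsKNormal Fq q n 1 α ∧ IsKNormal Fq q n 1 α⁻¹ := by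
    rintro ⟨x, hx, h1, h2⟩
    exact exists_primitive_pair_of_genericCheck hcard hq hn hdim h1 h2 (hd _) (hgeneric x hx)
  rcases hq with rfl | rfl
  · rcases Nat.lt_or_ge n 512 with h1 | h1
    · have := of_natAll factorCheck_two_lt_512 hn (by omega)
      simp only [Bool.or_eq_true] at this
      rcases this with ((h | h) | h) | h
      · exact absurd (mem_of_natElem h) hex
      all_goals exact exists_primitive_pair_of_factorCheck hcard (by norm_num) hn hdim h
    rcases Nat.lt_or_ge n 4096 with h2 | h2
    · exact exists_primitive_pair_of_genericCheck hcard (by norm_num) hn hdim le_rfl le_rfl (hg _)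
        (of_natAll genericCheck_two_lt_4096 h1 (by omega))
    · refine hcover ?_
      simp only [sieveIntervals, show Nat.beq 2 2 = true from rfl, cond_true, List.mem_cons,
        List.not_mem_nil, or_false, exists_eq_or_imp, exists_eq_left]
      omega
  · rcases Nat.lt_or_ge n 512 with h1 | h1
    · have := of_natAll factorCheck_three_lt_512 hn (by omega)
      simp only [Bool.or_eq_true] at this
      rcases this with (((h | h) | h) | h) | h
      · exact absurd (mem_of_natElem h) hex
      all_goals exact exists_primitive_pair_of_factorCheck hcard (by norm_num) hn hdim h
    rcases Nat.lt_or_ge n 2048 with h2 | h2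
    · have := of_natAll genericCheck_three_lt_2048 h1 (by omega)
      simp only [Bool.or_eq_true] at this
      rcases this with h | h
      · exact exists_primitive_pair_of_genericCheck hcard (by norm_num) hn hdim le_rfl le_rfl
          (hg _) h
      · exact exists_primitive_pair_of_factorCheck hcard (by norm_num) hn hdim h
    · refine hcover ?_
      simp only [sieveIntervals, show Nat.beq 3 2 = false from rfl, cond_false, List.mem_cons,
        List.not_mem_nil, or_false, exists_eq_or_imp, exists_eq_left]
      omega

end MediumRanges

section LargeDegrees

open Finset

theorem mul_degCount_lt {q d : ℕ} (hq : 0 < q) : d * degCount q d < q ^ d := by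
  have h1 : d * degCount q d ≤ q ^ d - 1 := Nat.mul_div_le _ _
  have h2 : 0 < q ^ d := pow_pos hq d
  omega

theorem mul_sum_degCount_le {q D : ℕ} (hq : q = 2 ∨ q = 3) (hD : 3 ≤ D) :
    D * ∑ d ∈ Icc 1 D, degCount q d ≤ 3 * q ^ D := by
  induction D, hD using Nat.le_induction with
  | base => rcases hq with rfl | rfl <;> decide +kernel
  | succ D hD ih =>
    rw [sum_Icc_succ_top (by omega), mul_add]
    have h1 := mul_degCount_lt (q := q) (d := D + 1) (by omega)
    set c := ∑ d ∈ Icc 1 D, degCount q d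
    have h2 : (D + 1) * c ≤ 2 * q ^ (D + 1) := by
      refine Nat.le_of_mul_le_mul_left ?_ (show 0 < D by omega)
      calc D * ((D + 1) * c) = (D + 1) * (D * c) := by ring
        _ ≤ (D + 1) * (3 * q ^ D) := Nat.mul_le_mul_left _ ih
        _ = (3 * (D + 1)) * q ^ D := by ring
        _ ≤ (D * (2 * q)) * q ^ D := Nat.mul_le_mul_right _ (by
            rcases hq with rfl | rfl <;> omega)
        _ = _ := by ring
    omega

theorem one_div_le_prod_degCount {q D : ℕ} (hq : q = 2 ∨ q = 3) (hD : 1 ≤ D) :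
    (1 / (3 * D) : ℝ) ≤ ∏ d ∈ Icc 1 D, (1 - 1 / (q : ℝ) ^ d) ^ degCount q d := by
  rw [← Finset.mul_prod_Ioc_eq_prod_Icc hD]
  have h1 : (1 / 3 : ℝ) ≤ (1 - 1 / (q : ℝ) ^ 1) ^ degCount q 1 := by
    rcases hq with rfl | rfl <;> norm_num [degCount]
  have h2 : (1 / D : ℝ) ≤ ∏ d ∈ Ioc 1 D, (1 - 1 / (q : ℝ) ^ d) ^ degCount q d := by
    rw [← prod_Icc_one_sub_inv hD, show Icc 2 D = Ioc 1 D from by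
      ext; simp only [mem_Icc, mem_Ioc]; omega]
    refine prod_le_prod (fun d hd => (one_sub_inv_mem (by have := mem_Ioc.1 hd; omega)).1)
      fun d hd => ?_
    have hd0 : (0 : ℝ) < d := by
      have := mem_Ioc.1 hd
      exact_mod_cast (by omega : 0 < d)
    have hq0 : (0 : ℝ) < (q : ℝ) ^ d := by
      rcases hq with rfl | rfl <;> positivity
    have hle : (1 : ℝ) ≤ (q : ℝ) ^ d := one_le_pow₀ (by rcases hq with rfl | rfl <;> norm_num)
    have hb := one_add_mul_le_pow (a := -(1 / (q : ℝ) ^ d)) (by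
      have : 1 / (q : ℝ) ^ d ≤ 1 := (div_le_one hq0).2 hle
      linarith) (degCount q d)
    rw [← sub_eq_add_neg] at hb
    refine le_trans ?_ hb
    have h3 : (d : ℝ) * degCount q d ≤ (q : ℝ) ^ d := by
      exact_mod_cast (mul_degCount_lt (d := d) (by omega : 0 < q)).le
    have h4 : (degCount q d : ℝ) * (1 / (q : ℝ) ^ d) ≤ 1 / d := by
      rw [mul_one_div, div_le_div_iff₀ hq0 hd0]
      linarith
    linarith
  calc (1 / (3 * D) : ℝ) = 1 / 3 * (1 / D) := by
        rw [one_div_mul_one_div]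
    _ ≤ _ := mul_le_mul h1 h2 (by positivity) (by linarith)

theorem mul_log_add_le {L : ℕ} (hL : 20 ≤ L) : 1000 * (14 * (L + 1) + 27) ≤ 2 ^ L := by
  induction L, hL using Nat.le_induction with
  | base => norm_num
  | succ L hL ih => rw [pow_succ]; omega

theorem two_pow_le_three_pow {y n : ℕ} (h : 2 * y ≤ 3 * n) : 2 ^ y ≤ 3 ^ n := by
  refine le_of_pow_le_pow_left₀ two_ne_zero (Nat.zero_le _) ?_
  calc (2 ^ y) ^ 2 = 2 ^ (2 * y) := by rw [← pow_mul, mul_comm]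
    _ ≤ 2 ^ (3 * n) := Nat.pow_le_pow_right (by norm_num) h
    _ = 8 ^ n := by rw [pow_mul]; norm_num
    _ ≤ 9 ^ n := Nat.pow_le_pow_left (by norm_num) n
    _ = (3 ^ n) ^ 2 := by rw [← pow_mul, mul_comm, pow_mul]; norm_num

theorem large_degree_bound {q n M c : ℕ} (hq : q = 2 ∨ q = 3) (hn : 2 ^ 20 ≤ n) (hM : 4 * M ≤ n)
    (hc : (if q = 2 then 289 else 121) * c ≤ 12 * n) :
    24 * 4096 * q ^ 8 * n ^ 14 * 256 ^ c * 4 ^ M < 7 * q ^ n := by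
  set L := Nat.log 2 n with hLdef
  have hL : 20 ≤ L := Nat.le_log_of_pow_le (by norm_num) hn
  have h1 : 2 ^ L ≤ n := Nat.pow_log_le_self 2 (by omega)
  have h2 : n < 2 ^ (L + 1) := Nat.lt_pow_succ_log_self (by norm_num) n
  have h3 := mul_log_add_le hL
  have h4 : 24 * 4096 * q ^ 8 ≤ 7 * 2 ^ 27 := by rcases hq with rfl | rfl <;> norm_num
  have h5 : n ^ 14 < 2 ^ ((L + 1) * 14) := by
    rw [pow_mul]; exact Nat.pow_lt_pow_left h2 (by norm_num)
  have h6 : 2 ^ (27 + (L + 1) * 14 + 8 * c + 2 * M) ≤ q ^ n := by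
    rcases hq with rfl | rfl
    · refine Nat.pow_le_pow_right (by norm_num) ?_
      rw [if_pos rfl] at hc
      omega
    · refine two_pow_le_three_pow ?_
      rw [if_neg (by norm_num)] at hc
      omega
  calc 24 * 4096 * q ^ 8 * n ^ 14 * 256 ^ c * 4 ^ M
      < 7 * 2 ^ 27 * 2 ^ ((L + 1) * 14) * 256 ^ c * 4 ^ M := by
        have := Nat.mul_lt_mul_of_le_of_lt h4 h5 (by norm_num)
        gcongr
    _ = 7 * 2 ^ (27 + (L + 1) * 14 + 8 * c + 2 * M) := by
      rw [show 256 = 2 ^ 8 by norm_num, show 4 = 2 ^ 2 by norm_num, ← pow_mul, ← pow_mul]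
      ring
    _ ≤ _ := by gcongr

variable {Fq F : Type*} [Field Fq] [Field F] [Fintype Fq] [Algebra Fq F] [Fintype F]

theorem exists_primitive_pair_of_two_pow_le {q n : ℕ} (hcard : Fintype.card Fq = q)
    (hq : q = 2 ∨ q = 3) (hn : 2 ^ 20 ≤ n) (hdim : Module.finrank Fq F = n) :
    ∃ α : F, α ≠ 0 ∧ orderOf α = q ^ n - 1 ∧ IsKNormal Fq q n 1 α ∧ IsKNormal Fq q n 1 α⁻¹ := by
  classical
  have hn0 : 0 < n := by omega
  have hq1 : (1 : ℝ) ≤ q := by rcases hq with rfl | rfl <;> norm_num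
  have hex : ∃ D : ℕ, 4 * n ≤ q ^ (D + 1) * (D + 1) :=
    ⟨4 * n, (Nat.le_succ _).trans (Nat.le_mul_of_pos_left _ (pow_pos (by omega) _))⟩
  obtain ⟨D, hD1, hD2⟩ : ∃ D : ℕ, 4 * n ≤ q ^ (D + 1) * (D + 1) ∧
      ∀ D' < D, q ^ (D' + 1) * (D' + 1) < 4 * n :=
    ⟨Nat.find hex, Nat.find_spec hex, fun D' h => not_le.1 (Nat.find_min hex h)⟩
  have hDb : (if q = 2 then 17 else 11) ≤ D := by
    by_contra hlt
    have h1 : ∀ b, D + 1 ≤ b → q ^ (D + 1) * (D + 1) ≤ q ^ b * b := fun b hb =>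
      Nat.mul_le_mul (Nat.pow_le_pow_right (by omega) hb) hb
    rcases hq with rfl | rfl
    · rw [if_pos rfl] at hlt
      have := h1 17 (by omega)
      norm_num at this hn
      omega
    · rw [if_neg (by norm_num)] at hlt
      have := h1 11 (by omega)
      norm_num at this hn
      omega
  have hD11 : 11 ≤ D := by split_ifs at hDb <;> omega
  have hD3 : q ^ D * D < 4 * n := by
    have := hD2 (D - 1) (by omega)
    rwa [Nat.sub_add_cancel (by omega)] at this
  have hDn : 3 * D ≤ n := by
    have h1 : 2 ^ 11 ≤ q ^ D :=
      (Nat.pow_le_pow_left (by omega : 2 ≤ q) 11).trans (Nat.pow_le_pow_right (by omega) hD11)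
    have h2 := Nat.mul_le_mul_right D h1
    omega
  set c := ∑ d ∈ Icc 1 D, degCount q d with hcdef
  have hc : (if q = 2 then 289 else 121) * c ≤ 12 * n := by
    have h1 : D * c ≤ 3 * q ^ D := mul_sum_degCount_le hq (by omega)
    have h2 : D * D * c ≤ 12 * n := by
      calc D * D * c = D * (D * c) := by ring
        _ ≤ D * (3 * q ^ D) := Nat.mul_le_mul_left _ h1
        _ = 3 * (q ^ D * D) := by ring
        _ ≤ _ := by omega
    refine le_trans (Nat.mul_le_mul_right c ?_) h2
    split_ifs at hDb ⊢
    · exact Nat.mul_le_mul hDb hDb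
    · exact Nat.mul_le_mul hDb hDb
  set M := n / 4 with hMdef
  have hM4 : 4 * M ≤ n := by omega
  have hM1 : 1 ≤ M := by omega
  set k := bitBound q n / 18 with hkdef
  have hk45 : 45 * k ≤ 4 * n := by
    have : 5 * bitBound q n ≤ 8 * n := by rw [bitBound]; split_ifs <;> omega
    omega
  have hN : q ^ n - 1 ≠ 0 := by
    have : 1 < q ^ n := Nat.one_lt_pow (by omega) (by omega)
    omega
  have hsd : (q ^ n - 1).primeFactors \ {p ∈ (q ^ n - 1).primeFactors | p ≤ M} =
      {p ∈ (q ^ n - 1).primeFactors | M < p} := by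
    rw [← filter_not]; simp only [not_le]
  have hk : #{p ∈ (q ^ n - 1).primeFactors | M < p} ≤ k := by
    rw [Nat.le_div_iff_mul_le (by omega), mul_comm]
    exact (mul_card_primeFactors_gt_le hN (by norm_num at hn ⊢; omega)).trans
      (log_two_le_bitBound hq)
  have ha : ∀ d ∈ Icc 1 D, #{P ∈ geomFactors Fq n | P.natDegree = d} ≤ degCount q d :=
    fun d hd => card_geomFactors_le_degCount hcard hn0 (mem_Icc.1 hd).1
  have hnR : (0 : ℝ) < n := by exact_mod_cast hn0
  set r := (n - 1) / (D + 1) with hrdef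
  have hr : r * (D + 1) ≤ n := (Nat.div_mul_le_self _ _).trans (by omega)
  have hr12 : 12 * r ≤ n := by
    have := Nat.mul_le_mul_left r (show 12 ≤ D + 1 by omega)
    omega
  refine exists_primitive_pair_of_bounds hcard (by omega) hdim (filter_subset (· ≤ M) _) D (4 ^ M) c
    k r (δC := 1 / n) (δA := 1 / n) (τ := 16 / 45) (σ := 1 / 4) (prod_primeFactors_le_four_pow _ M)
    (by positivity) (le_trans ?_ (inv_le_prod_primeFactors hM1 (q ^ n - 1))) (hsd ▸ hk) ?_
    (card_geomFactors_le hn0 ha) (by positivity)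
    (le_trans (le_trans ?_ (one_div_le_prod_degCount hq (by omega)))
      (prod_geomFactors_ge hn0 hq1 ha)) (card_geomFactors_lt_natDegree hn0 D) ?_ (by norm_num) ?_
  · exact one_div_le_one_div_of_le (by exact_mod_cast hM1) (by exact_mod_cast (by omega : M ≤ n))
  · rw [hsd]
    refine (sum_inv_primeFactors_gt_le hk).trans ?_
    rw [mul_one_div, div_le_div_iff₀ (by positivity) (by norm_num)]
    exact_mod_cast (by omega : k * 45 ≤ 16 * (M + 1))
  · refine one_div_le_one_div_of_le ?_ (by exact_mod_cast hDn)
    exact_mod_cast (by omega : 0 < 3 * D)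
  · refine (sum_inv_geomFactors_le (a := degCount q) (E := D) hn0 hq1 (by simp)).trans ?_
    have hq0 : (0 : ℝ) < (q : ℝ) ^ (D + 1) := by positivity
    rw [Ioc_self, sum_empty, zero_add, mul_one_div, div_le_div_iff₀ hq0 (by norm_num), one_mul]
    have : r * 4 ≤ q ^ (D + 1) := by
      refine Nat.le_of_mul_le_mul_right ?_ (show 0 < D + 1 by omega)
      refine le_trans ?_ hD1
      linarith
    exact_mod_cast this
  · have hmain := large_degree_bound hq hn hM4 hc
    have hmain' : (24 * 4096 * q ^ 8 * n ^ 14 * 256 ^ c * 4 ^ M : ℝ) < 7 * q ^ n := by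
      exact_mod_cast hmain
    have hK : (1 + k + 2 * r : ℝ) ≤ n := by exact_mod_cast (by omega : 1 + k + 2 * r ≤ n)
    rw [Nat.cast_pow, Nat.cast_ofNat]
    calc (24 * q ^ 8 * 256 ^ c * (1 + k + 2 * r) ^ 4 * 4 ^ M : ℝ)
        ≤ 24 * q ^ 8 * 256 ^ c * n ^ 4 * 4 ^ M := by gcongr
      _ = (24 * 4096 * q ^ 8 * n ^ 14 * 256 ^ c * 4 ^ M) * ((1 / n) ^ 10 * (1 / 8) ^ 4) := by
        field_simp
        ring
      _ < 7 * q ^ n * ((1 / n) ^ 10 * (1 / 8) ^ 4) :=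
        mul_lt_mul_of_pos_right hmain' (by positivity)
      _ = 7 * q ^ n * (1 / n) ^ 2 * (1 / n) ^ 8 * (1 / 8) ^ 4 := by ring
      _ ≤ _ := by
        gcongr
        norm_num

end LargeDegrees

section KroneckerEncoding

open Finset

/-- Evaluates its argument before applying `f`; this controls sharing in kernel reduction. -/
def natForce {α : Type} (n : ℕ) (f : ℕ → α) : α :=
  Nat.rec (motive := fun _ => α) (f 0) (fun i _ => f (Nat.succ i)) n

theorem natForce_eq {α : Type} (n : ℕ) (f : ℕ → α) : natForce n f = f n := by cases n <;> rfl

/-- The number with `L` digits `d` in base `2 ^ 20`. -/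
def digitMask (d L : ℕ) : ℕ :=
  Nat.rec (motive := fun _ => ℕ) 0 (fun _ a => Nat.add (Nat.mul 1048576 a) d) L

theorem digitMask_succ (d L : ℕ) : digitMask d (L + 1) = 1048576 * digitMask d L + d := rfl

theorem exists_polynomial_of_land_digitMask {d : ℕ} (hd : d < 1048576) {L N : ℕ}
    (h : Nat.land N (digitMask d L) = N) :
    ∃ p : ℕ[X], p.eval 1048576 = N ∧ p.eval 1 ≤ L * d ∧ ∀ i, L ≤ i → p.coeff i = 0 := by
  change N &&& digitMask d L = N at h
  induction L generalizing N with
  | zero =>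
    have hN : N = 0 := by rw [← h]; exact Nat.and_zero N
    exact ⟨0, by simp [hN], by simp, by simp⟩
  | succ L ih =>
    rw [digitMask_succ] at h
    have h1 : N % 2 ^ 20 ≤ d := by
      rw [← h, Nat.and_mod_two_pow]
      refine Nat.and_le_right.trans ?_
      norm_num
      omega
    have h2 : N / 2 ^ 20 &&& digitMask d L = N / 2 ^ 20 := by
      conv_rhs => rw [← h, Nat.and_div_two_pow]
      congr 1
      norm_num
      omega
    obtain ⟨p, hp1, hp2, hp3⟩ := ih h2
    refine ⟨X * p + C (N % 2 ^ 20), ?_, ?_, fun i hi => ?_⟩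
    · simp only [eval_add, eval_mul, eval_X, eval_C, hp1]
      exact Nat.div_add_mod N (2 ^ 20)
    · simp only [eval_add, eval_mul, eval_X, eval_C, one_mul, add_mul]
      omega
    · obtain ⟨j, rfl⟩ : ∃ j, i = j + 1 := ⟨i - 1, by omega⟩
      rw [coeff_add, coeff_X_mul, hp3 j (by omega), coeff_C_succ, add_zero]

theorem polynomial_nat_eq_of_eval_eq {b : ℕ} {p p' : ℕ[X]} (hp : p.eval 1 < b)
    (hp' : p'.eval 1 < b) (h : p.eval b = p'.eval b) : p = p' := by
  have hdecomp : ∀ (f : ℕ[X]) (a : ℕ), f.eval a = a * f.divX.eval a + f.coeff 0 := fun f a => by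
    conv_lhs => rw [← X_mul_divX_add f]
    simp
  induction hk : p.natDegree + p'.natDegree using Nat.strong_induction_on generalizing p p' with
  | _ k ih =>
    have e1 := hdecomp p 1
    have e2 := hdecomp p' 1
    have hc : p.coeff 0 = p'.coeff 0 := by
      rw [hdecomp p, hdecomp p'] at h
      have := congrArg (· % b) h
      simpa [Nat.mul_add_mod, Nat.mod_eq_of_lt (show p.coeff 0 < b by omega),
        Nat.mod_eq_of_lt (show p'.coeff 0 < b by omega)] using this
    rcases Nat.eq_zero_or_pos k with rfl | hk0
    · rw [eq_C_of_natDegree_eq_zero (show p.natDegree = 0 by omega),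
        eq_C_of_natDegree_eq_zero (show p'.natDegree = 0 by omega), hc]
    · have hd : p.divX = p'.divX := by
        refine ih _ ?_ (by omega) (by omega) ?_ rfl
        · rw [natDegree_divX_eq_natDegree_tsub_one, natDegree_divX_eq_natDegree_tsub_one]
          omega
        · rw [hdecomp p, hdecomp p', hc] at h
          exact Nat.eq_of_mul_eq_mul_left (by omega) (Nat.add_right_cancel h)
      rw [← X_mul_divX_add p, ← X_mul_divX_add p', hd, hc]

variable {R : Type*} [CommRing R]

/-- `N` encodes `y` as a polynomial in `x` via Kronecker substitution at `2 ^ 20`; the sum of the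
coefficients of the polynomial is at most `w`. -/
def Encodes (x : R) (w N : ℕ) (y : R) : Prop :=
  ∃ p : ℕ[X], p.eval 1048576 = N ∧ p.eval 1 ≤ w ∧ aeval x p = y

namespace Encodes

variable {x y y' : R} {w w' N N' : ℕ}

theorem mono (h : Encodes x w N y) (hw : w ≤ w') : Encodes x w' N y := by
  obtain ⟨p, h1, h2, h3⟩ := h
  exact ⟨p, h1, h2.trans hw, h3⟩

theorem add (h : Encodes x w N y) (h' : Encodes x w' N' y') :
    Encodes x (w + w') (N + N') (y + y') := by
  obtain ⟨p, h1, h2, h3⟩ := h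
  obtain ⟨p', h1', h2', h3'⟩ := h'
  exact ⟨p + p', by simp [h1, h1'], by rw [eval_add]; omega, by simp [h3, h3']⟩

theorem mul (h : Encodes x w N y) (h' : Encodes x w' N' y') :
    Encodes x (w * w') (N * N') (y * y') := by
  obtain ⟨p, h1, h2, h3⟩ := h
  obtain ⟨p', h1', h2', h3'⟩ := h'
  exact ⟨p * p', by simp [h1, h1'], by rw [eval_mul]; exact Nat.mul_le_mul h2 h2',
    by simp [h3, h3']⟩

theorem natCast (x : R) (c : ℕ) : Encodes x c c (c : R) := ⟨C c, by simp, by simp, by simp⟩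

theorem self (x : R) : Encodes x 1 1048576 x := ⟨X, by simp, by simp, by simp⟩

theorem unique (h : Encodes x w N y) (h' : Encodes x w' N y') (hw : w < 1048576)
    (hw' : w' < 1048576) : y = y' := by
  obtain ⟨p, h1, h2, h3⟩ := h
  obtain ⟨p', h1', h2', h3'⟩ := h'
  rw [← h3, ← h3', polynomial_nat_eq_of_eval_eq (h2.trans_lt hw) (h2'.trans_lt hw')
    (h1.trans h1'.symm)]

theorem exists_of_land {d L : ℕ} (x : R) (hd : d < 1048576)
    (h : Nat.land N (digitMask d L) = N) : ∃ y, Encodes x (L * d) N y := by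
  obtain ⟨p, h1, h2, _⟩ := exists_polynomial_of_land_digitMask hd h
  exact ⟨aeval x p, p, h1, h2, rfl⟩

end Encodes

/-- The data for computing with encodings modulo a monic polynomial with encoding `m`.
The number `mu` encodes the quotient used in Barrett reduction; `mulConst` and `shift` are such that
division by `q` is multiplication by `mulConst` followed by a shift. -/
structure ModData where
  q : ℕ
  mulConst : ℕ
  shift : ℕ
  remMask : ℕ
  quotMask : ℕ
  m : ℕ
  mu : ℕ
  bits : ℕ

namespace ModData

/-- Digitwise reduction modulo `q`. -/
def digitMod (M : ModData) (N : ℕ) : ℕ :=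
  natForce N fun N =>
    N - M.q * Nat.land (Nat.shiftRight (N * M.mulConst) M.shift) M.quotMask

/-- Checked digitwise reduction modulo `q`. -/
def reduceThen (M : ModData) (N : ℕ) (k : ℕ → Bool) : Bool :=
  natForce N fun N =>
  natForce (Nat.land (Nat.shiftRight (N * M.mulConst) M.shift) M.quotMask) fun c =>
  natForce (N - M.q * c) fun r =>
    Nat.beq (r + M.q * c) N && Nat.beq (Nat.land r M.remMask) r && k r

/-- Checked multiplication modulo the polynomial encoded by `m`. -/
def mulThen (M : ModData) (a b : ℕ) (k : ℕ → Bool) : Bool :=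
  natForce (a * b) fun N =>
  natForce (M.digitMod (Nat.shiftRight (M.digitMod (Nat.shiftRight N M.bits) * M.mu) M.bits))
    fun u => Nat.beq (Nat.land u M.remMask) u && M.reduceThen (N + (M.q - 1) * u * M.m) k

/-- Checked computation of `acc * base ^ e`. -/
def powThen (M : ModData) (fuel : ℕ) : ℕ → ℕ → ℕ → (ℕ → Bool) → Bool :=
  Nat.rec (motive := fun _ => ℕ → ℕ → ℕ → (ℕ → Bool) → Bool)
    (fun acc _ e k => Nat.beq e 0 && k acc)
    (fun _ ih acc base e k =>
      bif Nat.beq e 0 then k acc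
      else bif Nat.beq (e % 2) 1 then
        M.mulThen acc base fun acc' => M.mulThen base base fun base' =>
          natForce (e / 2) fun e' => ih acc' base' e' k
      else M.mulThen base base fun base' => natForce (e / 2) fun e' => ih acc base' e' k)
    fuel

/-- Checks that `(z * ∏ p ∈ l, (x ^ (N / p) - 1)) ^ N = 1`. -/
def orderCheck (M : ModData) (N : ℕ) (l : List ℕ) : ℕ → Bool :=
  List.rec (motive := fun _ => ℕ → Bool)
    (fun z => M.powThen 100 1 z N fun r => Nat.beq r 1)
    (fun p _ ih z => natForce (N / p) fun e => M.powThen 100 1 1048576 e fun a =>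
      M.mulThen z (a + (M.q - 1)) ih)
    l

/-- The prescribed leading coefficients in `traceCheck`. -/
def target (q i : ℕ) : ℕ := bif Nat.beq i 0 then 1 else bif Nat.beq i 1 then q - 1 else 0

/-- Checks that the conjugates `a ^ (q ^ j)` add up to `-s` and that the leading coefficient of
`lam * a ^ (q ^ j)` is `target q (i + j)`. -/
def traceCheck (M : ModData) (lam top topMask fuel : ℕ) : ℕ → ℕ → ℕ → Bool :=
  Nat.rec (motive := fun _ => ℕ → ℕ → ℕ → Bool)
    (fun _ _ s => M.reduceThen s fun r => Nat.beq r 0)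
    (fun _ ih i a s =>
      M.mulThen lam a fun r => natForce (r - target M.q i * top) fun r' =>
        Nat.beq (r' + target M.q i * top) r && Nat.beq (Nat.land r' topMask) r' &&
        M.powThen 2 1 a M.q fun a' => natForce (s + a) fun s' => natForce (i + 1) fun i' =>
          ih i' a' s')
    fuel

/-- The properties of `M` that make the checked operations correct at `x`. -/
structure Valid (M : ModData) (n : ℕ) (x : R) : Prop where
  q_cast : (M.q : R) = 0
  one_le_q : 1 ≤ M.q
  q_le : M.q ≤ 3
  n_le : n ≤ 60
  remMask_eq : M.remMask = digitMask 3 n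
  quotMask_eq : M.quotMask = digitMask 511 (2 * n)
  encodes_m : Encodes x 181 M.m 0

variable {M : ModData} {n : ℕ} {x : R}

theorem Valid.reduce (hM : M.Valid n x) {N w : ℕ} {k : ℕ → Bool} {y : R}
    (hN : Encodes x w N y) (hw : w < 1048576) (h : M.reduceThen N k = true) :
    ∃ r, Encodes x 180 r y ∧ k r = true := by
  simp only [reduceThen, natForce_eq, Bool.and_eq_true, Nat.beq_eq] at h
  set c := Nat.land (Nat.shiftRight (N * M.mulConst) M.shift) M.quotMask with hc
  obtain ⟨⟨h1, h2⟩, h3⟩ := h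
  set r := N - M.q * c
  refine ⟨r, ?_, h3⟩
  have hn := hM.n_le
  obtain ⟨y1, hr⟩ := Encodes.exists_of_land x (by norm_num) (hM.remMask_eq ▸ h2)
  obtain ⟨y2, hc'⟩ := Encodes.exists_of_land (N := c) (d := 511) (L := 2 * n) x (by norm_num) (by
    rw [← hM.quotMask_eq, hc]
    change (Nat.shiftRight (N * M.mulConst) M.shift &&& M.quotMask) &&& M.quotMask =
      Nat.shiftRight (N * M.mulConst) M.shift &&& M.quotMask
    rw [Nat.and_assoc, Nat.and_self])
  have hr' : Encodes x 180 r y1 := hr.mono (by omega)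
  have hc'' : Encodes x 61320 c y2 := hc'.mono (by omega)
  have hq : Encodes x 3 M.q (M.q : R) := (Encodes.natCast x M.q).mono hM.q_le
  have h4 := hr'.add (hq.mul hc'')
  rw [h1, hM.q_cast, zero_mul, add_zero] at h4
  rwa [hN.unique h4 hw (by norm_num)]

theorem Valid.mul (hM : M.Valid n x) {a b : ℕ} {k : ℕ → Bool} {y z : R}
    (ha : Encodes x 200 a y) (hb : Encodes x 200 b z) (h : M.mulThen a b k = true) :
    ∃ r, Encodes x 180 r (y * z) ∧ k r = true := by
  simp only [mulThen, natForce_eq, Bool.and_eq_true, Nat.beq_eq] at h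
  obtain ⟨h1, h2⟩ := h
  have hn := hM.n_le
  obtain ⟨y1, hu⟩ := Encodes.exists_of_land x (by norm_num) (hM.remMask_eq ▸ h1)
  have hu' := hu.mono (show n * 3 ≤ 180 by omega)
  have hq := (Encodes.natCast x (M.q - 1)).mono (show M.q - 1 ≤ 2 by have := hM.q_le; omega)
  have h3 := (ha.mul hb).add ((hq.mul hu').mul hM.encodes_m)
  rw [mul_zero, add_zero] at h3
  exact hM.reduce h3 (by norm_num) h2

theorem Valid.pow (hM : M.Valid n x) {fuel acc base e : ℕ} {k : ℕ → Bool} {y z : R}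
    (ha : Encodes x 180 acc y) (hb : Encodes x 200 base z)
    (h : M.powThen fuel acc base e k = true) :
    ∃ r, Encodes x 180 r (y * z ^ e) ∧ k r = true := by
  induction fuel generalizing acc base e y z with
  | zero =>
    have h' : (Nat.beq e 0 && k acc) = true := h
    rw [Bool.and_eq_true, Nat.beq_eq] at h'
    exact ⟨acc, by simpa [h'.1] using ha, h'.2⟩
  | succ fuel ih =>
    have h' : (bif Nat.beq e 0 then k acc
      else bif Nat.beq (e % 2) 1 then
        M.mulThen acc base fun acc' => M.mulThen base base fun base' =>
          natForce (e / 2) fun e' => M.powThen fuel acc' base' e' k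
      else M.mulThen base base fun base' =>
        natForce (e / 2) fun e' => M.powThen fuel acc base' e' k) = true := h
    simp only [natForce_eq] at h'
    cases h0 : Nat.beq e 0
    · rw [h0, cond_false] at h'
      have he : z ^ e = z ^ (e % 2) * (z * z) ^ (e / 2) := by
        rw [← sq, ← pow_mul, ← pow_add, Nat.mod_add_div]
      cases h1 : Nat.beq (e % 2) 1
      · rw [h1, cond_false] at h'
        have h2 : e % 2 = 0 := by
          have : e % 2 ≠ 1 := fun h => by simp [h] at h1
          omega
        obtain ⟨b', hb', h'⟩ := hM.mul hb hb h'
        rw [he, h2, pow_zero, one_mul]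
        exact ih ha (hb'.mono (by norm_num)) h'
      · rw [h1, cond_true] at h'
        obtain ⟨a', ha', h'⟩ := hM.mul (ha.mono (by norm_num)) hb h'
        obtain ⟨b', hb', h'⟩ := hM.mul hb hb h'
        rw [he, Nat.eq_of_beq_eq_true h1, pow_one, ← mul_assoc]
        exact ih ha' (hb'.mono (by norm_num)) h'
    · rw [h0, cond_true] at h'
      exact ⟨acc, by simpa [Nat.eq_of_beq_eq_true h0] using ha, h'⟩

theorem Valid.order (hM : M.Valid n x) {N z : ℕ} {l : List ℕ} {y : R}
    (hz : Encodes x 180 z y) (h : M.orderCheck N l z = true) :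
    (y * (l.map fun p => x ^ (N / p) - 1).prod) ^ N = 1 := by
  induction l generalizing z y with
  | nil =>
    have h' : (M.powThen 100 1 z N fun r => Nat.beq r 1) = true := h
    have h1 : Encodes x 1 1 (1 : R) := by simpa using Encodes.natCast x 1
    obtain ⟨r, hr, h'⟩ := hM.pow (h1.mono (by norm_num)) (hz.mono (by norm_num)) h'
    rw [Nat.eq_of_beq_eq_true h', one_mul] at hr
    rw [List.map_nil, List.prod_nil, mul_one]
    exact hr.unique h1 (by norm_num) (by norm_num)
  | cons p l ih =>
    have h' : (natForce (N / p) fun e => M.powThen 100 1 1048576 e fun a =>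
      M.mulThen z (a + (M.q - 1)) (M.orderCheck N l)) = true := h
    rw [natForce_eq] at h'
    have h1 : Encodes x 1 1 (1 : R) := by simpa using Encodes.natCast x 1
    obtain ⟨a, ha, h'⟩ := hM.pow (h1.mono (by norm_num)) ((Encodes.self x).mono (by norm_num)) h'
    have hq := (Encodes.natCast x (M.q - 1)).mono (show M.q - 1 ≤ 2 by have := hM.q_le; omega)
    rw [Nat.cast_sub hM.one_le_q, hM.q_cast] at hq
    obtain ⟨z', hz', h'⟩ := hM.mul (hz.mono (by norm_num)) ((ha.add hq).mono (by norm_num)) h'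
    have := ih hz' h'
    rw [one_mul, zero_sub, Nat.cast_one, ← sub_eq_add_neg] at this
    rwa [List.map_cons, List.prod_cons, ← mul_assoc]

theorem Valid.trace (hM : M.Valid n x) {lam top topMask fuel i a s w : ℕ} {v y z : R}
    (hn : 1 ≤ n) (htop : top = 1048576 ^ (n - 1)) (hmask : topMask = digitMask 3 (n - 1))
    (hlam : Encodes x 180 lam v) (ha : Encodes x 180 a y) (hs : Encodes x w s z)
    (hw : w + 180 * fuel < 1048576)
    (h : M.traceCheck lam top topMask fuel i a s = true) :
    z + ∑ j ∈ range fuel, y ^ M.q ^ j = 0 ∧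
    ∀ j < fuel, ∃ p : ℕ[X], (∀ l, n ≤ l → p.coeff l = 0) ∧ p.coeff (n - 1) = target M.q (i + j) ∧
      aeval x p = v * y ^ M.q ^ j := by
  induction fuel generalizing i a s w y z with
  | zero =>
    have h' : (M.reduceThen s fun r => Nat.beq r 0) = true := h
    obtain ⟨r, hr, h'⟩ := hM.reduce hs (by omega) h'
    rw [Nat.eq_of_beq_eq_true h'] at hr
    have h0 : Encodes x 0 0 (0 : R) := by simpa using Encodes.natCast x 0
    simpa using hr.unique h0 (by norm_num) (by norm_num)
  | succ fuel ih =>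
    have h' : (M.mulThen lam a fun r => natForce (r - target M.q i * top) fun r' =>
        Nat.beq (r' + target M.q i * top) r && Nat.beq (Nat.land r' topMask) r' &&
        M.powThen 2 1 a M.q fun a' => natForce (s + a) fun s' => natForce (i + 1) fun i' =>
          M.traceCheck lam top topMask fuel i' a' s') = true := h
    simp only [natForce_eq] at h'
    obtain ⟨r, hr, h'⟩ := hM.mul (hlam.mono (by norm_num)) (ha.mono (by norm_num)) h'
    rw [Bool.and_eq_true, Bool.and_eq_true, Nat.beq_eq, Nat.beq_eq] at h'
    obtain ⟨⟨h1, h2⟩, h'⟩ := h'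
    have hone : Encodes x 1 1 (1 : R) := by simpa using Encodes.natCast x 1
    obtain ⟨a', ha', h'⟩ := hM.pow (hone.mono (by norm_num)) (ha.mono (by norm_num)) h'
    rw [one_mul] at ha'
    obtain ⟨ih1, ih2⟩ := ih ha' (hs.add ha) (by omega) h'
    refine ⟨?_, fun j hj => ?_⟩
    · rw [sum_range_succ', pow_zero, pow_one, ← ih1]
      simp only [pow_succ' M.q, pow_mul]
      ring
    · rcases Nat.eq_zero_or_pos j with rfl | hj0
      · obtain ⟨p, hp1, hp2, hp3⟩ := exists_polynomial_of_land_digitMask (by norm_num) (hmask ▸ h2)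
        have ht : target M.q i ≤ 3 := by
          have := hM.q_le
          rw [target]
          cases Nat.beq i 0 <;> cases Nat.beq i 1 <;> simp <;> omega
        refine ⟨p + C (target M.q i) * X ^ (n - 1), fun l hl => ?_, ?_, ?_⟩
        · rw [coeff_add, hp3 l (by omega), coeff_C_mul, coeff_X_pow, if_neg (by omega), mul_zero,
            add_zero]
        · rw [coeff_add, hp3 _ le_rfl, coeff_C_mul, coeff_X_pow, if_pos rfl, mul_one, zero_add,
            add_zero]
        · rw [pow_zero, pow_one]
          refine Encodes.unique (x := x) (N := r) (w := 1000) (w' := 180)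
            ⟨_, ?_, ?_, rfl⟩ hr (by norm_num) (by norm_num)
          · simp only [eval_add, eval_mul, eval_C, eval_pow, eval_X, hp1]
            rw [← htop, h1]
          · simp only [eval_add, eval_mul, eval_C, eval_pow, eval_X, one_pow, mul_one]
            have := hM.n_le
            omega
      · obtain ⟨p, hp1, hp2, hp3⟩ := ih2 (j - 1) (by omega)
        refine ⟨p, hp1, ?_, ?_⟩
        · rw [hp2]; congr 1; omega
        · rw [hp3, ← pow_mul, ← pow_succ', Nat.sub_add_cancel hj0]

end ModData

end KroneckerEncoding

section Witness

open Finset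

/-- The number in base `2 ^ 20` with the same digits as `N` in base `q`. -/
def spreadDigits (q fuel : ℕ) : ℕ → ℕ :=
  Nat.rec (motive := fun _ => ℕ → ℕ) (fun _ => 0)
    (fun _ ih N => natForce (N / q) fun N' => N % q + 1048576 * ih N') fuel

/-- Primality by trial division. -/
def primeCheck (p : ℕ) : Bool :=
  Nat.ble 2 p && natAll (fun b => natAll (fun d => Nat.ble p d || !Nat.beq (p % d) 0)
    (2 + 64 * b) 64) 0 (2 ^ (Nat.log2 p / 2 + 1) / 64 + 1)

/-- A certificate for the existence of a primitive pair in degree `n`. The numbers `modulus`,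
`barrett`, `dual`, `dualInv` pack coefficients in base `q`: the minimal polynomial of a generator
without its leading term, the quotient of `X ^ (2 * n)` by it, and elements which pair
the conjugates of the generator, respectively of its inverse, to prescribed values. -/
structure Witness where
  n : ℕ
  modulus : ℕ
  barrett : ℕ
  dual : ℕ
  dualInv : ℕ
  primes : List ℕ

/-- The modular arithmetic attached to a certificate. -/
def Witness.modData (W : Witness) (q : ℕ) (k : ModData → Bool) : Bool :=
  natForce (digitMask 3 W.n) fun remMask => natForce (digitMask 511 (2 * W.n)) fun quotMask =>
  natForce (spreadDigits q 64 W.modulus) fun m' => Nat.beq (Nat.land m' remMask) m' &&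
  natForce (1048576 ^ W.n + m') fun m => natForce (spreadDigits q 64 W.barrett) fun mu =>
  natForce (20 * W.n) fun bits =>
    bif Nat.beq q 2 then k ⟨q, 1, 1, remMask, quotMask, m, mu, bits⟩
    else k ⟨q, 683, 11, remMask, quotMask, m, mu, bits⟩

/-- Verification of a certificate. -/
def Witness.check (W : Witness) (q : ℕ) : Bool :=
  natForce (q ^ W.n - 1) fun N => natForce (1048576 ^ (W.n - 1)) fun top =>
  natForce (digitMask 3 (W.n - 1)) fun topMask =>
  natForce (spreadDigits q 64 W.dual) fun lam => natForce (spreadDigits q 64 W.dualInv) fun lam' =>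
    Nat.ble 2 W.n && Nat.ble W.n 60 &&
    W.primes.all primeCheck && Nat.beq (W.primes.prod ^ 100 % N) 0 &&
    W.modData q fun M =>
      Nat.beq (Nat.land lam M.remMask) lam && Nat.beq (Nat.land lam' M.remMask) lam' &&
      (M.powThen 100 1 1048576 N fun r => Nat.beq r 1) &&
      M.orderCheck N W.primes 1 &&
      M.traceCheck lam top topMask W.n 0 1048576 0 &&
      M.powThen 100 1 1048576 (N - 1) fun b => M.traceCheck lam' top topMask W.n 0 b 0

/-- Certificates over the field with two elements. -/
def witnessesTwo : List Witness :=
  [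
    ⟨14, 3101, 19813, 14755, 8999,
      [3, 43, 127]⟩,
    ⟨15, 7785, 40105, 16100, 14319,
      [7, 31, 151]⟩,
    ⟨16, 18081, 86921, 51342, 63619,
      [3, 5, 17, 257]⟩,
    ⟨17, 45557, 170607, 63539, 20927,
      [131071]⟩,
    ⟨18, 48789, 306518, 237691, 234831,
      [3, 7, 19, 73]⟩,
    ⟨19, 73525, 605173, 213872, 206539,
      [524287]⟩,
    ⟨20, 109137, 1163203, 1025082, 660727,
      [3, 5, 11, 31, 41]⟩,
    ⟨21, 59373, 2155840, 968964, 379315,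
      [7, 127, 337]⟩,
    ⟨22, 599365, 4719056, 3806307, 2185931,
      [3, 23, 89, 683]⟩,
    ⟨24, 5549025, 21094478, 13045889, 9635363,
      [3, 5, 7, 13, 17, 241]⟩,
    ⟨26, 11505133, 79447252, 61894736, 51049923,
      [3, 2731, 8191]⟩,
    ⟨27, 26130949, 161584787, 63149114, 17971179,
      [7, 73, 262657]⟩,
    ⟨28, 2635593, 271086562, 258945100, 252551531,
      [3, 5, 29, 43, 113, 127]⟩,
    ⟨30, 15931469, 1089621841, 957355784, 580883975,
      [3, 7, 11, 31, 151, 331]⟩,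
    ⟨32, 794543449, 5027439017, 3911117997, 3954332443,
      [3, 5, 17, 257, 65537]⟩,
    ⟨33, 3094773605, 11062286601, 3626470275, 2221643307,
      [7, 23, 89, 599479]⟩,
    ⟨34, 1826137581, 18953973300, 15667029767, 15812559971,
      [3, 43691, 131071]⟩,
    ⟨35, 2043251993, 36431288774, 15695272516, 15461880315,
      [31, 71, 127, 122921]⟩,
    ⟨36, 24287793729, 90087696164, 56457985533, 66713173203,
      [3, 5, 7, 13, 19, 37, 73, 109]⟩,
    ⟨38, 110639312381, 401137934258, 209526499006, 146963218163,
      [3, 174763, 524287]⟩,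
    ⟨40, 65490235641, 1165708158425, 1032814746055, 630143506495,
      [3, 5, 11, 17, 31, 41, 61681]⟩,
    ⟨42, 735887424041, 5190632132611, 4003274942353, 3524994980075,
      [3, 7, 43, 127, 337, 5419]⟩,
    ⟨44, 3579919982293, 21027399213468, 15453173879860, 15566726207903,
      [3, 5, 23, 89, 397, 683, 2113]⟩,
    ⟨45, 15464895635957, 48693130768201, 15992366575270, 14266639990511,
      [7, 31, 73, 151, 631, 23311]⟩,
    ⟨48, 74503709782305, 376772532161247, 242107214550531, 245027468675683,
      [3, 5, 7, 13, 17, 97, 241, 257, 673]⟩,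
    ⟨54, 7011599016364793, 25997413415442818, 13667853054694194, 16174963398178811,
      [3, 7, 19, 73, 87211, 262657]⟩,
    ⟨56, 6503751350833557, 78277630925071371, 67166744483179849, 40009259118789963,
      [3, 5, 17, 29, 43, 113, 127, 15790321]⟩,
    ⟨60, 137968221880743641, 1296742265276314694, 1055973852726600381, 988142888181205067,
      [3, 5, 7, 11, 13, 31, 41, 61, 151, 331, 1321]⟩]

/-- Certificates over the field with three elements. -/
def witnessesThree : List Witness :=
  [
    ⟨14, 1593038, 5629095, 993240, 358705,
      [2, 547, 1093]⟩,
    ⟨15, 1432918, 15078308, 11704130, 12225347,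
      [2, 11, 13, 4561]⟩,
    ⟨16, 7300685, 55968691, 6691522, 13695940,
      [2, 5, 17, 41, 193]⟩,
    ⟨17, 11616508, 137507660, 23481049, 17839268,
      [2, 1871, 34511]⟩,
    ⟨18, 100768403, 467104466, 185218615, 272150629,
      [2, 7, 13, 19, 37, 757]⟩,
    ⟨20, 418081025, 4329119844, 531791940, 509475406,
      [2, 5, 11, 61, 1181]⟩,
    ⟨21, 11007190, 10465889187, 5381100032, 7783477001,
      [2, 13, 1093, 368089]⟩,
    ⟨22, 5765638511, 41456426100, 4904437738, 10367729533,
      [2, 23, 67, 661, 3851]⟩,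
    ⟨24, 46605308798, 368277800505, 229304009004, 260034749005,
      [2, 5, 7, 13, 41, 73, 6481]⟩,
    ⟨26, 319402656686, 3109992724804, 377132223709, 615306810310,
      [2, 398581, 797161]⟩,
    ⟨28, 7497171765254, 26942905391590, 3687336870122, 3457310028907,
      [2, 5, 29, 547, 1093, 16493]⟩,
    ⟨30, 39677517647021, 262254423185023, 97595654264137, 118854000995665,
      [2, 7, 11, 13, 31, 61, 271, 4561]⟩,
    ⟨32, 183112299597773, 1949055669015120, 262176849251885, 70701771299779,
      [2, 5, 17, 41, 193, 21523361]⟩,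
    ⟨36, 13031748770124053, 159683067509015174, 122857736881101897, 129888202712707720,
      [2, 5, 7, 13, 19, 37, 73, 757, 530713]⟩,
    ⟨40, 2236822503546204614, 16105178004986509111, 1354284969980756344, 3615382709821835296,
      [2, 5, 11, 41, 61, 1181, 42521761]⟩,
    ⟨48, 26079323459674095713162, 93977609667780966688105, 36118824666568089367966,
      45668023195451130492211,
      [2, 5, 7, 13, 17, 41, 73, 97, 193, 577, 769, 6481]⟩,
    ⟨56, 92164585567869922683317843, 697152579975153146710821431,
      62656523958326570418993517, 130654960600089074458784599,
      [2, 5, 29, 41, 547, 1093, 16493, 430697, 647753]⟩]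

set_option maxRecDepth 100000 in
theorem check_witnessesTwo : witnessesTwo.all (fun W => W.check 2) = true := by
  decide +kernel

set_option maxRecDepth 100000 in
theorem check_witnessesThree : witnessesThree.all (fun W => W.check 3) = true := by
  decide +kernel

end Witness

section WitnessSound

open Finset IntermediateField

theorem prime_of_primeCheck {p : ℕ} (h : primeCheck p = true) : p.Prime := by
  rw [primeCheck, Bool.and_eq_true, Nat.ble_eq] at h
  obtain ⟨h2, h⟩ := h
  by_contra hp
  have hdvd := Nat.minFac_dvd p
  have hsq := Nat.minFac_sq_le_self (by omega) hp
  have htwo := (Nat.minFac_prime (show p ≠ 1 by omega)).two_le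
  set d := p.minFac
  have hlog : p < 2 ^ (Nat.log2 p + 1) := Nat.lt_log2_self
  have hpow : 2 ^ (Nat.log2 p + 1) ≤ (2 ^ (Nat.log2 p / 2 + 1)) ^ 2 := by
    rw [← pow_mul]
    exact Nat.pow_le_pow_right (by norm_num) (by omega)
  have hd : d < 2 ^ (Nat.log2 p / 2 + 1) := lt_of_pow_lt_pow_left₀ 2 (by positivity) (by omega)
  have hb := of_natAll (n := (d - 2) / 64) h (by omega) (by omega)
  have hc := of_natAll (n := d) hb (by omega) (by omega)
  rw [Bool.or_eq_true, Nat.ble_eq] at hc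
  rcases hc with hc | hc
  · have : 2 * d ≤ d ^ 2 := by rw [sq]; exact Nat.mul_le_mul_right d htwo
    omega
  · simp [Nat.mod_eq_zero_of_dvd hdvd] at hc

theorem exists_mem_of_dvd_prod_pow {l : List ℕ} (hl : ∀ p ∈ l, p.Prime) {N e p : ℕ}
    (hN : N ∣ l.prod ^ e) (hp : p.Prime) (hpN : p ∣ N) : p ∈ l := by
  obtain ⟨p', hp', hdvd⟩ := hp.prime.dvd_prod_iff.1 (hp.dvd_of_dvd_pow (hpN.trans hN))
  rwa [(Nat.prime_dvd_prime_iff_eq hp (hl _ hp')).1 hdvd]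

theorem exists_root_of_root_pow_eq_one {Fq F : Type*} [Field Fq] [Field F] [Algebra Fq F]
    [Fintype F] {N : ℕ} (hN : Fintype.card F = N + 1) {f : Fq[X]}
    (hf : f.degree ≠ 0) (h : AdjoinRoot.root f ^ N = 1) : ∃ α : F, aeval α f = 0 := by
  have hdvd : f ∣ X ^ N - 1 := by
    rw [← AdjoinRoot.mk_eq_zero, map_sub, map_pow, AdjoinRoot.mk_X, h, map_one, sub_self]
  have hdvd' : f.map (algebraMap Fq F) ∣
      (X ^ Fintype.card F - X : Fq[X]).map (algebraMap Fq F) := by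
    have := (map_dvd (mapRingHom (algebraMap Fq F)) hdvd).mul_right X
    rwa [coe_mapRingHom, Polynomial.map_sub, Polynomial.map_pow, map_X, Polynomial.map_one,
      sub_mul, ← pow_succ, one_mul, ← hN, ← map_X (algebraMap Fq F), ← Polynomial.map_pow,
      ← Polynomial.map_sub] at this
  have hsplit := (FiniteField.isSplittingField_sub F Fq).splits.of_dvd
    (map_ne_zero (FiniteField.X_pow_card_sub_X_ne_zero Fq Fintype.one_lt_card)) hdvd'
  obtain ⟨α, hα⟩ := hsplit.exists_eval_eq_zero (by rwa [degree_map])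
  exact ⟨α, by rwa [eval_map_algebraMap] at hα⟩

variable {Fq F : Type*} [Field Fq] [Field F] [Fintype Fq] [Algebra Fq F] [Fintype F]

theorem eq_zero_of_aeval_eq_zero_of_orderOf {n : ℕ} (hn : 1 ≤ n)
    {α : F} (hα : orderOf α = Fintype.card Fq ^ n - 1) {P : Fq[X]} (hP : ∀ l, n ≤ l → P.coeff l = 0)
    (h : aeval α P = 0) : P = 0 := by
  by_contra hP0
  have h1 : 1 < Fintype.card Fq := Fintype.one_lt_card
  have hα0 : α ≠ 0 := by
    rintro rfl
    rw [orderOf_zero] at hα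
    have := Nat.one_lt_pow (show n ≠ 0 by omega) h1
    omega
  set d := (minpoly Fq α).natDegree with hd
  have hintegral : IsIntegral Fq α := Algebra.IsIntegral.isIntegral α
  have hdP : d ≤ P.natDegree := natDegree_le_of_dvd (minpoly.dvd Fq α h) hP0
  have hPn : P.natDegree < n := by
    by_contra hlt
    exact hP0 (leadingCoeff_eq_zero.1 (hP _ (by omega)))
  have hcard : Nat.card Fq⟮α⟯ = Fintype.card Fq ^ d := by
    rw [Module.natCard_eq_pow_finrank (K := Fq), Nat.card_eq_fintype_card,
      adjoin.finrank hintegral]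
  have hpow : α ^ (Fintype.card Fq ^ d - 1) = 1 := by
    have hg : AdjoinSimple.gen Fq α ≠ 0 := fun h0 => hα0 (by
      rw [← AdjoinSimple.algebraMap_gen Fq α, h0, map_zero])
    have := Fintype.ofFinite Fq⟮α⟯
    have h2 := FiniteField.pow_card_sub_one_eq_one _ hg
    rw [← Nat.card_eq_fintype_card, hcard] at h2
    simpa using congrArg (algebraMap Fq⟮α⟯ F) h2
  have hdvd := orderOf_dvd_of_pow_eq_one hpow
  have hdpos : 0 < d := minpoly.natDegree_pos hintegral
  have := Nat.one_lt_pow hdpos.ne' h1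
  have hlt := Nat.pow_lt_pow_right h1 (hdP.trans_lt hPn)
  have := Nat.le_of_dvd (by omega) hdvd
  omega

theorem isKNormal_one_of_dual {q n : ℕ} (hcard : Fintype.card Fq = q) (hn : 2 ≤ n)
    (hdim : Module.finrank Fq F = n) {α β v : F}
    (hα : ∀ P : Fq[X], (∀ l, n ≤ l → P.coeff l = 0) → aeval α P = 0 → P = 0)
    (htr : ∑ j ∈ range n, β ^ q ^ j = 0)
    (hdual : ∀ j < n, ∃ P : Fq[X], (∀ l, n ≤ l → P.coeff l = 0) ∧
      P.coeff (n - 1) = (if j = 0 then 1 else if j = 1 then -1 else 0) ∧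
      aeval α P = v * β ^ q ^ j) : IsKNormal Fq q n 1 β := by
  subst hcard
  refine ⟨geomPoly Fq n, ⟨geomPoly_monic (by omega), ⟨_, (geomPoly_mul n).symm⟩, ?_,
    fun h hmonic _ hact => ?_⟩, natDegree_geomPoly (by omega)⟩
  · rw [polyAct_eq_frobAct, frobAct, geomPoly, map_sum, LinearMap.sum_apply, ← htr]
    exact sum_congr rfl fun i _ => by rw [map_pow, aeval_X, frobeniusAlgHom_pow_apply]
  · rw [natDegree_geomPoly (by omega)]
    by_contra! hlt
    have hroot : ∀ k, ∑ i ∈ range n, algebraMap Fq F (h.coeff i) *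
        β ^ Fintype.card Fq ^ ((i + k) % n) = 0 := fun k => by
      have hper : ∀ i, β ^ Fintype.card Fq ^ (i % n) = β ^ Fintype.card Fq ^ i := fun i => by
        conv_rhs => rw [← Nat.mod_add_div i n, pow_add, pow_mul, pow_mul]
        have hF : Fintype.card F = Fintype.card Fq ^ n := by
          rw [Module.card_eq_pow_finrank (K := Fq), hdim]
        rw [← hF, FiniteField.pow_card_pow]
      have hk : frobAct Fq F (X ^ k * h) β = 0 := by
        rw [frobAct_mul_apply, ← polyAct_eq_frobAct h, hact, map_zero]
      rw [mul_comm, frobAct_mul_apply, frobAct, aeval_eq_sum_range' (n := n) (by omega)] at hk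
      rw [← hk, LinearMap.sum_apply]
      refine sum_congr rfl fun i _ => ?_
      rw [LinearMap.smul_apply, frobeniusAlgHom_pow_apply, frobAct, map_pow, aeval_X,
        frobeniusAlgHom_pow_apply, Algebra.smul_def, hper, ← pow_mul, ← pow_add, add_comm k]
    choose! P hPn hPt hPv using hdual
    have hcoeff : ∀ k, ∑ i ∈ range n, h.coeff i *
        (if (i + k) % n = 0 then 1 else if (i + k) % n = 1 then -1 else 0) = 0 := fun k => by
      have hmod : ∀ i, (i + k) % n < n := fun i => Nat.mod_lt _ (by omega)
      have h0 := hα (∑ i ∈ range n, C (h.coeff i) * P ((i + k) % n))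
        (fun l hl => by
          rw [finsetSum_coeff]
          exact sum_eq_zero fun i _ => by rw [coeff_C_mul, hPn _ (hmod i) l hl, mul_zero])
        (by
          rw [map_sum, ← mul_zero v, ← hroot k, mul_sum]
          refine sum_congr rfl fun i _ => ?_
          rw [map_mul, aeval_C, hPv _ (hmod i)]
          ring)
      have h1 := congrArg (fun p => coeff p (n - 1)) h0
      simp only [finsetSum_coeff, coeff_C_mul, coeff_zero] at h1
      exact (sum_congr rfl fun i _ => by rw [hPt _ (hmod i)]).trans h1
    have hstep : ∀ i, i + 1 < n → h.coeff i = h.coeff (i + 1) := fun i hi => by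
      have h1 := hcoeff (n - i)
      rw [← sum_subset (s₁ := {i, i + 1}) (by intro j hj; simp at hj ⊢; omega)
        (fun j hj hj' => by
          rw [mem_range] at hj
          rw [mem_insert, mem_singleton] at hj'
          have : (j + (n - i)) % n = if j < i then j + n - i else j - i := by
            split_ifs
            · exact Nat.mod_eq_of_lt (by omega) |>.trans (by omega)
            · rw [show j + (n - i) = j - i + n by omega, Nat.add_mod_right,
                Nat.mod_eq_of_lt (by omega)]
          rw [if_neg (by split_ifs at this <;> omega), if_neg (by split_ifs at this <;> omega),
            mul_zero]), sum_pair (by omega), show i + (n - i) = n by omega,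
        show i + 1 + (n - i) = 1 + n by omega, Nat.mod_self, Nat.add_mod_right,
        Nat.mod_eq_of_lt (by omega : 1 < n)] at h1
      simpa [← sub_eq_add_neg, sub_eq_zero] using h1
    have hzero : ∀ j < n, h.coeff (n - 1 - j) = 0 := fun j => by
      induction j with
      | zero => exact fun _ => coeff_eq_zero_of_natDegree_lt (by omega)
      | succ j ih =>
        intro hj
        rw [hstep _ (by omega), show n - 1 - (j + 1) + 1 = n - 1 - j by omega, ih (by omega)]
    have := hzero (n - 1 - h.natDegree) (by omega)
    rw [show n - 1 - (n - 1 - h.natDegree) = h.natDegree by omega] at this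
    exact hmonic.ne_zero (leadingCoeff_eq_zero.1 this)

theorem ModData.valid_of_aeval_eq_zero {R : Type*} [CommRing R] {M : ModData} {n : ℕ}
    {p : ℕ[X]} (hq : M.q = 2 ∨ M.q = 3) (hn : n ≤ 60) (hrem : M.remMask = digitMask 3 n)
    (hquot : M.quotMask = digitMask 511 (2 * n)) (hm : M.m = 1048576 ^ n + p.eval 1048576)
    (hp : p.eval 1 ≤ n * 3) {x : R} (hqx : (M.q : R) = 0) (hx : aeval x (X ^ n + p) = 0) :
    M.Valid n x :=
  ⟨hqx, by omega, by omega, hn, hrem, hquot, X ^ n + p, by simp [hm], by simp; omega, hx⟩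

theorem Witness.modData_eq_true {W : Witness} {q : ℕ} {k : ModData → Bool}
    (h : W.modData q k = true) :
    ∃ (M : ModData) (p : ℕ[X]), k M = true ∧ M.q = q ∧ M.remMask = digitMask 3 W.n ∧
      M.quotMask = digitMask 511 (2 * W.n) ∧ M.m = 1048576 ^ W.n + p.eval 1048576 ∧
      p.eval 1 ≤ W.n * 3 ∧ ∀ i, W.n ≤ i → p.coeff i = 0 := by
  simp only [modData, natForce_eq, Bool.and_eq_true, Nat.beq_eq] at h
  obtain ⟨h1, h⟩ := h
  obtain ⟨p, hp1, hp2, hp3⟩ := exists_polynomial_of_land_digitMask (by norm_num) h1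
  rw [← hp1] at h
  cases hq : Nat.beq q 2
  · rw [hq, cond_false] at h
    exact ⟨_, p, h, rfl, rfl, rfl, rfl, hp2, hp3⟩
  · rw [hq, cond_true] at h
    exact ⟨_, p, h, rfl, rfl, rfl, rfl, hp2, hp3⟩

variable {q : ℕ} {W : Witness}

theorem Witness.exists_primitive_pair (hq : q = 2 ∨ q = 3) (hcard : Fintype.card Fq = q)
    (hdim : Module.finrank Fq F = W.n) (h : W.check q = true) :
    ∃ α : F, α ≠ 0 ∧ orderOf α = q ^ W.n - 1 ∧ IsKNormal Fq q W.n 1 α ∧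
      IsKNormal Fq q W.n 1 α⁻¹ := by
  simp only [check, natForce_eq, Bool.and_eq_true, Nat.beq_eq, Nat.ble_eq] at h
  obtain ⟨⟨⟨⟨hn2, hn⟩, hprimes⟩, hprod⟩, h⟩ := h
  obtain ⟨M, p, h, rfl, hrem, hquot, hm, hp, hpn⟩ := modData_eq_true h
  simp only [Bool.and_eq_true, Nat.beq_eq] at h
  obtain ⟨⟨⟨⟨⟨hlam, hlam'⟩, hone⟩, hord⟩, htr⟩, hinv⟩ := h
  have hQ : 1 < M.q ^ W.n := Nat.one_lt_pow (by omega) (by omega)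
  have hF : Fintype.card F = M.q ^ W.n - 1 + 1 := by
    rw [Module.card_eq_pow_finrank (K := Fq), hdim, hcard]
    omega
  have hq0 : (M.q : Fq) = 0 := by rw [← hcard, FiniteField.cast_card_eq_zero]
  set f : Fq[X] := (X ^ W.n + p).map (algebraMap ℕ Fq) with hf
  have hfdeg : f.degree = W.n := by
    rw [hf, Polynomial.map_add, Polynomial.map_pow, map_X, degree_add_eq_left_of_degree_lt,
      degree_X_pow]
    rw [degree_X_pow, degree_lt_iff_coeff_zero]
    exact fun i hi => by rw [coeff_map, hpn i hi, map_zero]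
  have hroot : AdjoinRoot.root f ^ (M.q ^ W.n - 1) = 1 := by
    have hM : M.Valid W.n (AdjoinRoot.root f) := by
      refine ModData.valid_of_aeval_eq_zero hq hn hrem hquot hm hp ?_ ?_
      · rw [← map_natCast (algebraMap Fq _), hq0, map_zero]
      · rw [← aeval_map_algebraMap Fq, ← hf, AdjoinRoot.aeval_eq, AdjoinRoot.mk_self]
    have h1 : Encodes (AdjoinRoot.root f) 1 1 1 := by simpa using Encodes.natCast _ 1
    obtain ⟨r, hr, hr1⟩ := hM.pow (h1.mono (by norm_num)) ((Encodes.self _).mono (by norm_num)) hone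
    rw [Nat.eq_of_beq_eq_true hr1, one_mul] at hr
    exact hr.unique h1 (by norm_num) (by norm_num)
  obtain ⟨α, hα⟩ := exists_root_of_root_pow_eq_one hF (by rw [hfdeg]; norm_cast; omega) hroot
  have hM : M.Valid W.n α := by
    refine ModData.valid_of_aeval_eq_zero hq hn hrem hquot hm hp ?_ ?_
    · rw [← map_natCast (algebraMap Fq _), hq0, map_zero]
    · rw [← aeval_map_algebraMap Fq, ← hf, hα]
  have h1 : Encodes α 1 1 1 := by simpa using Encodes.natCast α 1
  have h0 : Encodes α 0 0 0 := by simpa using Encodes.natCast α 0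
  have hself : Encodes α 180 1048576 α := (Encodes.self α).mono (by norm_num)
  have hpow : α ^ (M.q ^ W.n - 1) = 1 := by
    obtain ⟨r, hr, hr1⟩ := hM.pow (h1.mono (by norm_num)) (hself.mono (by norm_num)) hone
    rw [Nat.eq_of_beq_eq_true hr1, one_mul] at hr
    exact hr.unique h1 (by norm_num) (by norm_num)
  have hα0 : α ≠ 0 := by
    rintro rfl
    rw [zero_pow (by omega)] at hpow
    exact zero_ne_one hpow
  have horder : orderOf α = M.q ^ W.n - 1 := by
    refine orderOf_eq_of_pow_and_pow_div_prime (by omega) hpow fun r hr hrN hr1 => ?_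
    have hmem := exists_mem_of_dvd_prod_pow
      (fun p hp => prime_of_primeCheck (List.all_eq_true.1 hprimes p hp))
      (Nat.dvd_of_mod_eq_zero hprod) hr hrN
    have := hM.order (h1.mono (by norm_num)) hord
    rw [List.prod_eq_zero (List.mem_map.2 ⟨r, hmem, by rw [hr1, sub_self]⟩), mul_zero,
      zero_pow (by omega)] at this
    exact zero_ne_one this
  have hdeg : ∀ P : Fq[X], (∀ l, W.n ≤ l → P.coeff l = 0) → aeval α P = 0 → P = 0 :=
    fun P hP hP' => eq_zero_of_aeval_eq_zero_of_orderOf (by omega) (hcard ▸ horder) hP hP'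
  have hnormal : ∀ {lam b : ℕ} {β : F}, Nat.land lam M.remMask = lam → Encodes α 180 b β →
      M.traceCheck lam (1048576 ^ (W.n - 1)) (digitMask 3 (W.n - 1)) W.n 0 b 0 = true →
      IsKNormal Fq M.q W.n 1 β := fun {lam b β} hl hb ht => by
    obtain ⟨v, hv⟩ := Encodes.exists_of_land α (by norm_num) (hrem ▸ hl)
    obtain ⟨hsum, hdual⟩ := hM.trace (by omega) rfl rfl (hv.mono (by omega)) hb h0 (by omega) ht
    refine isKNormal_one_of_dual hcard hn2 hdim hdeg (by rwa [zero_add] at hsum)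
      (v := v) fun j hj => ?_
    obtain ⟨P, hP1, hP2, hP3⟩ := hdual j hj
    refine ⟨P.map (algebraMap ℕ Fq), fun l hl => by rw [coeff_map, hP1 l hl, map_zero], ?_,
      by rw [aeval_map_algebraMap, hP3]⟩
    rw [coeff_map, hP2, zero_add]
    rcases j with _ | _ | j
    · exact Nat.cast_one
    · change ((M.q - 1 : ℕ) : Fq) = -1
      rw [Nat.cast_sub hM.one_le_q, hq0, Nat.cast_one, zero_sub]
    · exact Nat.cast_zero
  refine ⟨α, hα0, horder, hnormal hlam hself htr, ?_⟩
  obtain ⟨b, hb, ht⟩ := hM.pow (h1.mono (by norm_num)) (hself.mono (by norm_num)) hinv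
  refine hnormal hlam' ?_ ht
  rwa [one_mul, eq_inv_of_mul_eq_one_left (a := α ^ (M.q ^ W.n - 1 - 1)) (b := α)
    (by rw [← pow_succ, Nat.sub_add_cancel (by omega), hpow])] at hb

theorem exists_primitive_pair_of_mem_exceptionalDegrees {n : ℕ} (hq : q = 2 ∨ q = 3)
    (hcard : Fintype.card Fq = q) (hdim : Module.finrank Fq F = n)
    (hex : n ∈ exceptionalDegrees q) :
    ∃ α : F, α ≠ 0 ∧ orderOf α = q ^ n - 1 ∧ IsKNormal Fq q n 1 α ∧ IsKNormal Fq q n 1 α⁻¹ := by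
  rcases hq with rfl | rfl
  · have hW : n ∈ witnessesTwo.map Witness.n := hex
    obtain ⟨W, hmem, rfl⟩ := List.mem_map.1 hW
    exact W.exists_primitive_pair (.inl rfl) hcard hdim
      (List.all_eq_true.1 check_witnessesTwo W hmem)
  · have hW : n ∈ witnessesThree.map Witness.n := hex
    obtain ⟨W, hmem, rfl⟩ := List.mem_map.1 hW
    exact W.exists_primitive_pair (.inr rfl) hcard hdim
      (List.all_eq_true.1 check_witnessesThree W hmem)

end WitnessSound

/-- For `q ∈ {2, 3}` and every `n ≥ 14` there is `α ∈ F_{q^n}^*` such that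
both `α` and `α⁻¹` are simultaneously primitive and `1`-normal over `F_q`. -/
theorem exists_primitive_one_normal_pair_of_q_two_or_three
    (q n : ℕ) (hq : q = 2 ∨ q = 3) (hn : 14 ≤ n)
    (Fq F : Type*) [Field Fq] [Field F] [Fintype Fq] [Fintype F] [Algebra Fq F]
    (hcard : Fintype.card Fq = q) (hdim : Module.finrank Fq F = n) :
    ∃ α : F, α ≠ 0 ∧ orderOf α = q ^ n - 1 ∧ orderOf α⁻¹ = q ^ n - 1 ∧
      IsKNormal Fq q n 1 α ∧ IsKNormal Fq q n 1 α⁻¹ := by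
  obtain ⟨α, h0, h1, h2, h3⟩ : ∃ α : F, α ≠ 0 ∧ orderOf α = q ^ n - 1 ∧
      IsKNormal Fq q n 1 α ∧ IsKNormal Fq q n 1 α⁻¹ := by
    by_cases hex : n ∈ exceptionalDegrees q
    · exact exists_primitive_pair_of_mem_exceptionalDegrees hq hcard hdim hex
    · rcases lt_or_ge n (2 ^ 20) with hlt | hge
      · exact exists_primitive_pair_of_lt_two_pow hcard hq hn hlt hdim hex
      · exact exists_primitive_pair_of_two_pow_le hcard hq hge hdim
  refine ⟨α, h0, h1, ?_, h2, h3⟩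
  rw [← h1, ← Units.val_mk0 h0, ← Units.val_inv_eq_inv_val, orderOf_units, orderOf_units,
    orderOf_inv]

end
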